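/- arXiv:2308.03085 — 2 statements merged into one kernel-verified Lean document; each statement's English description precedes it below -/
import Mathlib

section
/- Let F be a face of codimension k ≥ 2 of a monotone polytope P ⊆ ℝ^n. Then the following are equivalent: (1) P admits a monotone blow-up at F, i.e., every vertex of P not in F satisfies u_F·v ≤ 0 and the polytope P ∩ {x : u_F·x ≤ 1} is again monotone; (2) every edge of P with exactly one endpoint in F has lattice length at least k. Moreover, in this case the new facet created by the blow-up lies in the hyperplane {x : u_F·x = 1}, i.e., the blow-up has size k − 1. -/
open Finset

/-- Real dot product of an integer vector with a real vector. -/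
def dotZ {n : ℕ} (u : Fin n → ℤ) (x : Fin n → ℝ) : ℝ := ∑ i, (u i : ℝ) * x i

/-- Real dot product. -/
def dotR {n : ℕ} (u x : Fin n → ℝ) : ℝ := ∑ i, u i * x i

/-- A point of `ℝ^n` is a lattice point if all its coordinates are integers. -/
def IsLatticePt {n : ℕ} (x : Fin n → ℝ) : Prop := ∀ i, ∃ m : ℤ, x i = (m : ℝ)

/-- A (full-dimensional) lattice polytope: the convex hull of a finite set of
lattice points whose affine span is all of `ℝ^n`. -/
def IsLatticePolytope {n : ℕ} (P : Set (Fin n → ℝ)) : Prop :=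
  ∃ V : Finset (Fin n → ℝ), (∀ v ∈ V, IsLatticePt v) ∧
    P = convexHull ℝ (V : Set (Fin n → ℝ)) ∧ affineSpan ℝ P = ⊤

/-- `F` is an (exposed) face of `P`: the set of maximizers over `P` of some
linear functional. -/
def IsFaceOf {n : ℕ} (P F : Set (Fin n → ℝ)) : Prop :=
  ∃ u : Fin n → ℝ, F = {x ∈ P | ∀ y ∈ P, dotR u y ≤ dotR u x}

/-- The dimension of a subset of `ℝ^n` (dimension of its affine hull). -/
noncomputable def dimSet {n : ℕ} (F : Set (Fin n → ℝ)) : ℕ :=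
  Module.finrank ℝ (vectorSpan ℝ F)

/-- A facet of `P`: a nonempty face of dimension `n - 1`. -/
def IsFacetOf {n : ℕ} (P F : Set (Fin n → ℝ)) : Prop :=
  IsFaceOf P F ∧ F.Nonempty ∧ dimSet F + 1 = n

/-- A vertex of `P`: a point such that `{v}` is a face. -/
def IsVertexOf {n : ℕ} (P : Set (Fin n → ℝ)) (v : Fin n → ℝ) : Prop :=
  IsFaceOf P {v}

/-- An edge of `P`: a face which is a nondegenerate segment. -/
def IsEdgeOf {n : ℕ} (P E : Set (Fin n → ℝ)) : Prop :=
  IsFaceOf P E ∧ ∃ a b : Fin n → ℝ, a ≠ b ∧ E = segment ℝ a b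

/-- An integer vector is primitive if the gcd of its coordinates is 1. -/
def IsPrimitiveZ {n : ℕ} (u : Fin n → ℤ) : Prop := Finset.univ.gcd u = 1

/-- `u` is the primitive outer normal of the facet `F` of `P`. -/
def IsFacetNormal {n : ℕ} (P F : Set (Fin n → ℝ)) (u : Fin n → ℤ) : Prop :=
  IsPrimitiveZ u ∧ IsFacetOf P F ∧
    F = {x ∈ P | ∀ y ∈ P, dotZ u y ≤ dotZ u x}

/-- `u` is the central normal vector of the face `G` of `P`: the sum of the
primitive outer normals of all the facets of `P` containing `G`. -/
def IsCentralNormal {n : ℕ} (P G : Set (Fin n → ℝ)) (u : Fin n → ℤ) : Prop :=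
  ∃ (m : ℕ) (Fs : Fin m → Set (Fin n → ℝ)) (us : Fin m → Fin n → ℤ),
    Function.Injective Fs ∧
    (∀ i, G ⊆ Fs i ∧ IsFacetNormal P (Fs i) (us i)) ∧
    (∀ F, IsFacetOf P F → G ⊆ F → ∃ i, F = Fs i) ∧
    u = ∑ i, us i

/-- The lattice length of the segment from `a` to `b`. -/
def LatticeLength {n : ℕ} (a b : Fin n → ℝ) (ℓ : ℕ) : Prop :=
  ∃ d : Fin n → ℤ, IsPrimitiveZ d ∧ ∀ i, b i - a i = (ℓ : ℝ) * (d i : ℝ)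

/-- `d` is the primitive integer direction vector of the edge `E` at its
endpoint `v`, pointing away from `v`. -/
def EdgeDirAt {n : ℕ} (v : Fin n → ℝ) (E : Set (Fin n → ℝ)) (d : Fin n → ℤ) : Prop :=
  IsPrimitiveZ d ∧ ∃ w ∈ E, ∃ t : ℝ, 0 < t ∧ ∀ i, w i - v i = t * (d i : ℝ)

/-- A polytope is smooth (Delzant) if every vertex lies in exactly `n` facets
and the primitive direction vectors of the `n` edges incident to each vertex
form a basis of the lattice `ℤ^n`. -/
def IsSmoothPolytope {n : ℕ} (P : Set (Fin n → ℝ)) : Prop :=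
  ∀ v : Fin n → ℝ, IsVertexOf P v →
    (∃ Fs : Fin n → Set (Fin n → ℝ), Function.Injective Fs ∧
      (∀ i, IsFacetOf P (Fs i) ∧ v ∈ Fs i) ∧
      (∀ F, IsFacetOf P F → v ∈ F → ∃ i, F = Fs i)) ∧
    (∃ (E : Fin n → Set (Fin n → ℝ)) (d : Fin n → Fin n → ℤ),
      Function.Injective E ∧
      (∀ i, IsEdgeOf P (E i) ∧ v ∈ E i ∧ EdgeDirAt v (E i) (d i)) ∧
      (∀ E', IsEdgeOf P E' → v ∈ E' → ∃ i, E' = E i) ∧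
      IsUnit (Matrix.det (Matrix.of d)))

/-- A polytope is reflexive if the origin is in its interior and every facet is
supported at value `1` by its primitive outer normal. -/
def IsReflexivePolytope {n : ℕ} (P : Set (Fin n → ℝ)) : Prop :=
  (0 : Fin n → ℝ) ∈ interior P ∧
  ∀ F u, IsFacetNormal P F u → ∀ x ∈ F, dotZ u x = 1

/-- A monotone polytope (= smooth reflexive polytope). -/
def IsMonotonePolytope {n : ℕ} (P : Set (Fin n → ℝ)) : Prop :=
  IsLatticePolytope P ∧ IsSmoothPolytope P ∧ IsReflexivePolytope P

/-- `F` is a nonempty face of `P` of codimension `k`. -/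
def HasCodim {n : ℕ} (P F : Set (Fin n → ℝ)) (k : ℕ) : Prop :=
  IsFaceOf P F ∧ F.Nonempty ∧ dimSet F + k = n

/-- The monotone blow-up `P ∩ {x : u·x ≤ 1}` of a monotone polytope at a face
with central normal `u`. -/
def blowupSet {n : ℕ} (P : Set (Fin n → ℝ)) (u : Fin n → ℤ) : Set (Fin n → ℝ) :=
  {x ∈ P | dotZ u x ≤ 1}

/-- The region removed from `P` by the monotone blow-up with central normal `u`. -/
def removedRegion {n : ℕ} (P : Set (Fin n → ℝ)) (u : Fin n → ℤ) : Set (Fin n → ℝ) :=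
  {x ∈ P | 1 < dotZ u x}

/-- `P` admits a monotone blow-up at its face `F` with central normal `u`:
every vertex of `P` not in `F` satisfies `u·v ≤ 0`, and the blow-up is again a
monotone polytope. -/
def AdmitsMonotoneBlowup {n : ℕ} (P F : Set (Fin n → ℝ)) (u : Fin n → ℤ) : Prop :=
  IsCentralNormal P F u ∧
  (∀ v, IsVertexOf P v → v ∉ F → dotZ u v ≤ 0) ∧
  IsMonotonePolytope (blowupSet P u)

/-- The monotone simplex `{x : x i ≥ -1 ∀ i, ∑ x i ≤ 1}` in `ℝ^n`. -/
def monotoneSimplex (n : ℕ) : Set (Fin n → ℝ) :=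
  {x | (∀ i, -1 ≤ x i) ∧ ∑ i, x i ≤ 1}

/-- `AGL(n,ℤ)`-equivalence of subsets of `ℝ^n`: some map `x ↦ Ax + t` with
`A ∈ GL(n,ℤ)` and `t ∈ ℤ^n` maps `P` onto `Q`. -/
def AGLEquiv {n : ℕ} (P Q : Set (Fin n → ℝ)) : Prop :=
  ∃ (A : Matrix (Fin n) (Fin n) ℤ) (t : Fin n → ℤ), IsUnit A.det ∧
    (fun x : Fin n → ℝ => fun i => (∑ j, (A i j : ℝ) * x j) + (t i : ℝ)) '' P = Q

/-- An integer vector, seen as a real vector. -/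
def intVec {n : ℕ} (d : Fin n → ℤ) : Fin n → ℝ := fun i => (d i : ℝ)

theorem dotZ_eq {n : ℕ} (u : Fin n → ℤ) (x : Fin n → ℝ) : dotZ u x = intVec u ⬝ᵥ x := rfl

theorem dotR_eq {n : ℕ} (c x : Fin n → ℝ) : dotR c x = c ⬝ᵥ x := rfl

theorem intVec_dotProduct {n : ℕ} (u d : Fin n → ℤ) :
    intVec u ⬝ᵥ intVec d = ((u ⬝ᵥ d : ℤ) : ℝ) := by
  simp [intVec, dotProduct]

theorem intVec_sub {n : ℕ} (u d : Fin n → ℤ) : intVec (u - d) = intVec u - intVec d := by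
  ext; simp [intVec]

theorem intVec_neg {n : ℕ} (u : Fin n → ℤ) : intVec (-u) = -intVec u := by
  ext; simp [intVec]

theorem intVec_sum {n : ℕ} {ι : Type*} (s : Finset ι) (u : ι → Fin n → ℤ) :
    intVec (∑ i ∈ s, u i) = ∑ i ∈ s, intVec (u i) := by
  ext; simp [intVec]

theorem intVec_injective {n : ℕ} : Function.Injective (intVec (n := n)) := by
  intro x y h
  ext i
  have := congrFun h i
  simpa [intVec] using this

theorem continuous_const_dotProduct {n : ℕ} (c : Fin n → ℝ) :
    Continuous (fun x : Fin n → ℝ => c ⬝ᵥ x) :=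
  continuous_const.dotProduct continuous_id

/-- The convex hull of finitely many points. -/
def IsPolytopeHull {n : ℕ} (P : Set (Fin n → ℝ)) : Prop :=
  ∃ V : Finset (Fin n → ℝ), P = convexHull ℝ (V : Set (Fin n → ℝ))

theorem IsPolytopeHull.isCompact {n : ℕ} {P : Set (Fin n → ℝ)} (hP : IsPolytopeHull P) :
    IsCompact P := by
  obtain ⟨V, rfl⟩ := hP
  exact V.finite_toSet.isCompact_convexHull ℝ

theorem IsPolytopeHull.convex {n : ℕ} {P : Set (Fin n → ℝ)} (hP : IsPolytopeHull P) :
    Convex ℝ P := by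
  obtain ⟨V, rfl⟩ := hP
  exact convex_convexHull ℝ _

/-- A linear functional bounded on a set is bounded on its convex hull. -/
theorem dotProduct_le_of_mem_convexHull {n : ℕ} {V : Set (Fin n → ℝ)} {c : Fin n → ℝ} {m : ℝ}
    (h : ∀ w ∈ V, c ⬝ᵥ w ≤ m) {x : Fin n → ℝ} (hx : x ∈ convexHull ℝ V) : c ⬝ᵥ x ≤ m := by
  refine convexHull_min (t := {x | c ⬝ᵥ x ≤ m}) h ?_ hx
  rw [convex_iff_forall_pos]
  intro x hx y hy a b ha hb hab
  simp only [Set.mem_ofPred_eq, dotProduct_add, dotProduct_smul, smul_eq_mul] at *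
  obtain rfl : b = 1 - a := by linarith
  nlinarith

/-- The points of a convex hull where a linear functional attains its bound are spanned by the
generators where it does. -/
theorem mem_convexHull_of_dotProduct_eq {n : ℕ} {V : Set (Fin n → ℝ)} {c : Fin n → ℝ} {m : ℝ}
    (h : ∀ w ∈ V, c ⬝ᵥ w ≤ m) {x : Fin n → ℝ} (hx : x ∈ convexHull ℝ V) (hxm : c ⬝ᵥ x = m) :
    x ∈ convexHull ℝ {w ∈ V | c ⬝ᵥ w = m} := by
  set K := convexHull ℝ {w ∈ V | c ⬝ᵥ w = m} with hK
  have hKm : ∀ y ∈ K, c ⬝ᵥ y ≤ m := fun y hy =>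
    dotProduct_le_of_mem_convexHull (fun w hw => h w hw.1) hy
  have key : convexHull ℝ V ⊆ {x | c ⬝ᵥ x < m} ∪ K := by
    refine convexHull_min ?_ ?_
    · intro w hw
      rcases (h w hw).lt_or_eq with h1 | h1
      · exact Or.inl h1
      · exact Or.inr (subset_convexHull ℝ _ ⟨hw, h1⟩)
    · rw [convex_iff_forall_pos]
      intro x hx y hy a b ha hb hab
      have hlt : ∀ x y : Fin n → ℝ, c ⬝ᵥ x ≤ m → c ⬝ᵥ y ≤ m → (c ⬝ᵥ x < m ∨ c ⬝ᵥ y < m) →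
          c ⬝ᵥ (a • x + b • y) < m := by
        intro x y hx hy hxy
        simp only [dotProduct_add, dotProduct_smul, smul_eq_mul]
        obtain rfl : b = 1 - a := by linarith
        rcases hxy with h1 | h1 <;> nlinarith
      rcases hx with hx | hx <;> rcases hy with hy | hy
      · exact Or.inl (hlt x y (le_of_lt hx) (le_of_lt hy) (Or.inl hx))
      · exact Or.inl (hlt x y (le_of_lt hx) (hKm y hy) (Or.inl hx))
      · exact Or.inl (hlt x y (hKm x hx) (le_of_lt hy) (Or.inr hy))
      · exact Or.inr (convex_convexHull ℝ _ hx hy ha.le hb.le hab)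
  rcases key hx with h1 | h1
  · exact absurd hxm (ne_of_lt h1)
  · exact h1

/-- A continuous linear functional on `ℝ^n` is a dot product. -/
theorem exists_dotProduct_eq {n : ℕ} (f : (Fin n → ℝ) →L[ℝ] ℝ) :
    ∃ c : Fin n → ℝ, ∀ x, f x = c ⬝ᵥ x := by
  refine ⟨fun i => f (fun j => if i = j then 1 else 0), fun x => ?_⟩
  have := LinearMap.pi_apply_eq_sum_univ f.toLinearMap x
  simp only [ContinuousLinearMap.coe_coe] at this
  rw [this]
  simp [dotProduct, mul_comm]

/-- A point outside a compact convex set is strictly separated from it. -/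
theorem exists_dotProduct_lt {n : ℕ} {K : Set (Fin n → ℝ)} (hK : Convex ℝ K) (hc : IsClosed K)
    {x : Fin n → ℝ} (hx : x ∉ K) : ∃ c : Fin n → ℝ, ∀ y ∈ K, c ⬝ᵥ y < c ⬝ᵥ x := by
  obtain ⟨f, s, h1, h2⟩ := geometric_hahn_banach_closed_point hK hc hx
  obtain ⟨c, hc⟩ := exists_dotProduct_eq f
  refine ⟨c, fun y hy => ?_⟩
  rw [← hc, ← hc]
  exact (h1 y hy).trans h2

theorem IsFaceOf.isExtreme {n : ℕ} {P G : Set (Fin n → ℝ)} (hG : IsFaceOf P G) :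
    IsExtreme ℝ P G := by
  obtain ⟨c, rfl⟩ := hG
  refine ⟨fun x hx => hx.1, ?_⟩
  rintro x hx y hy z hz ⟨a, b, ha, hb, hab, rfl⟩
  refine ⟨hx, fun w hw => (hz.2 w hw).trans ?_⟩
  have h1 := hz.2 y hy
  simp only [dotR_eq, dotProduct_add, dotProduct_smul, smul_eq_mul] at *
  obtain rfl : b = 1 - a := by linarith
  nlinarith

theorem IsFaceOf.subset {n : ℕ} {P G : Set (Fin n → ℝ)} (hG : IsFaceOf P G) : G ⊆ P :=
  hG.isExtreme.subset

theorem IsVertexOf.mem {n : ℕ} {P : Set (Fin n → ℝ)} {v : Fin n → ℝ} (hv : IsVertexOf P v) :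
    v ∈ P :=
  hv.subset rfl

theorem IsVertexOf.mem_extremePoints {n : ℕ} {P : Set (Fin n → ℝ)} {v : Fin n → ℝ}
    (hv : IsVertexOf P v) : v ∈ Set.extremePoints ℝ P :=
  isExtreme_singleton.1 hv.isExtreme

theorem IsVertexOf.mem_of_convexHull {n : ℕ} {V : Set (Fin n → ℝ)} {v : Fin n → ℝ}
    (hv : IsVertexOf (convexHull ℝ V) v) : v ∈ V :=
  extremePoints_convexHull_subset hv.mem_extremePoints

theorem IsVertexOf.exists_exposing {n : ℕ} {P : Set (Fin n → ℝ)} {v : Fin n → ℝ}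
    (hv : IsVertexOf P v) : ∃ c : Fin n → ℝ, ∀ w ∈ P, w ≠ v → c ⬝ᵥ w < c ⬝ᵥ v := by
  obtain ⟨c, hc⟩ := hv
  have hvv : v ∈ {x ∈ P | ∀ y ∈ P, dotR c y ≤ dotR c x} := hc ▸ rfl
  refine ⟨c, fun w hw hne => lt_of_le_of_ne (hvv.2 w hw) fun heq => hne ?_⟩
  have : w ∈ ({v} : Set (Fin n → ℝ)) := by
    rw [hc]
    exact ⟨hw, fun y hy => (hvv.2 y hy).trans heq.ge⟩
  exact this

theorem IsPolytopeHull.isVertexOf {n : ℕ} {P : Set (Fin n → ℝ)} (hP : IsPolytopeHull P)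
    {v : Fin n → ℝ} (hv : v ∈ Set.extremePoints ℝ P) : IsVertexOf P v := by
  obtain ⟨V, rfl⟩ := hP
  have hvV := extremePoints_convexHull_subset hv
  rw [(convex_convexHull ℝ _).mem_extremePoints_iff_mem_sdiff_convexHull_sdiff] at hv
  have hv2 : v ∉ convexHull ℝ ((V : Set (Fin n → ℝ)) \ {v}) := fun h =>
    hv.2 (convexHull_mono (Set.sdiff_subset_sdiff_left (subset_convexHull ℝ _)) h)
  obtain ⟨c, hc⟩ := exists_dotProduct_lt (convex_convexHull ℝ _)
    ((V.finite_toSet.subset Set.sdiff_subset).isCompact_convexHull ℝ).isClosed hv2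
  have hle : ∀ w ∈ (V : Set (Fin n → ℝ)), c ⬝ᵥ w ≤ c ⬝ᵥ v := by
    intro w hw
    by_cases h : w = v
    · rw [h]
    · exact (hc w (subset_convexHull ℝ _ ⟨hw, h⟩)).le
  refine ⟨c, Set.eq_of_subset_of_subset ?_ ?_⟩
  · rintro x rfl
    exact ⟨hv.1, fun y hy => dotProduct_le_of_mem_convexHull hle hy⟩
  · rintro x ⟨hx, hx2⟩
    have := mem_convexHull_of_dotProduct_eq hle hx
      (le_antisymm (dotProduct_le_of_mem_convexHull hle hx) (hx2 v hv.1))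
    refine (convexHull_min (t := {v}) ?_ (convex_singleton v)) this
    rintro w ⟨hw, hw2⟩
    by_contra h
    exact absurd hw2 (ne_of_lt (hc w (subset_convexHull ℝ _ ⟨hw, h⟩)))

/-- A nonempty face of a polytope contains a vertex. -/
theorem IsPolytopeHull.exists_vertex_mem_face {n : ℕ} {P G : Set (Fin n → ℝ)}
    (hP : IsPolytopeHull P) (hG : IsFaceOf P G) (hne : G.Nonempty) :
    ∃ v, IsVertexOf P v ∧ v ∈ G := by
  have hcl : IsCompact G := by
    obtain ⟨c, hc⟩ := hG
    have : G = P ∩ ⋂ y ∈ P, {x | c ⬝ᵥ y ≤ c ⬝ᵥ x} := by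
      rw [hc]; ext x; simp [dotR_eq]
    rw [this]
    exact hP.isCompact.inter_right (isClosed_biInter fun y _ =>
      isClosed_le continuous_const (continuous_const_dotProduct c))
  obtain ⟨v, hv⟩ := hcl.extremePoints_nonempty hne
  exact ⟨v, hP.isVertexOf (hG.isExtreme.extremePoints_subset_extremePoints hv), hv.1⟩

theorem IsPolytopeHull.exists_vertex_max {n : ℕ} {P : Set (Fin n → ℝ)}
    (hP : IsPolytopeHull P) (hne : P.Nonempty) (c : Fin n → ℝ) :
    ∃ v, IsVertexOf P v ∧ ∀ y ∈ P, c ⬝ᵥ y ≤ c ⬝ᵥ v := by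
  obtain ⟨x, hx, hmax⟩ := hP.isCompact.exists_isMaxOn hne
    (continuous_const_dotProduct c).continuousOn
  obtain ⟨v, hv, hv2⟩ := hP.exists_vertex_mem_face (G := {x ∈ P | ∀ y ∈ P, dotR c y ≤ dotR c x})
    ⟨c, rfl⟩ ⟨x, hx, hmax⟩
  exact ⟨v, hv, hv2.2⟩

theorem IsPolytopeHull.dotProduct_le {n : ℕ} {P : Set (Fin n → ℝ)}
    (hP : IsPolytopeHull P) {c : Fin n → ℝ} {m : ℝ} (h : ∀ v, IsVertexOf P v → c ⬝ᵥ v ≤ m)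
    {x : Fin n → ℝ} (hx : x ∈ P) : c ⬝ᵥ x ≤ m := by
  obtain ⟨v, hv, hv2⟩ := hP.exists_vertex_max ⟨x, hx⟩ c
  exact (hv2 x hx).trans (h v hv)

theorem IsPolytopeHull.finite_vertices {n : ℕ} {P : Set (Fin n → ℝ)}
    (hP : IsPolytopeHull P) : {v | IsVertexOf P v}.Finite := by
  obtain ⟨V, rfl⟩ := hP
  exact V.finite_toSet.subset fun v hv => IsVertexOf.mem_of_convexHull hv

/-- If a linear functional is not maximal at a vertex of a polytope, then it increases along some
edge at that vertex. -/
theorem IsPolytopeHull.exists_increasing_edge {n : ℕ} {P : Set (Fin n → ℝ)}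
    (hP : IsPolytopeHull P) {v x : Fin n → ℝ} (hv : IsVertexOf P v) (hx : x ∈ P)
    {g : Fin n → ℝ} (hg : g ⬝ᵥ v < g ⬝ᵥ x) :
    ∃ w, w ≠ v ∧ IsEdgeOf P (segment ℝ v w) ∧ g ⬝ᵥ v < g ⬝ᵥ w := by
  classical
  obtain ⟨c, hc⟩ := hv.exists_exposing
  have hconv := hP.convex
  have hvP := hv.mem
  obtain ⟨V, hV⟩ := hP
  have hVP : ∀ w ∈ V, w ∈ P := fun w hw => hV ▸ subset_convexHull ℝ _ hw
  set dir : (Fin n → ℝ) → (Fin n → ℝ) := fun w => (c ⬝ᵥ v - c ⬝ᵥ w)⁻¹ • (w - v) with hdir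
  have hpos : ∀ w ∈ V, w ≠ v → 0 < c ⬝ᵥ v - c ⬝ᵥ w := fun w hw h => by
    linarith [hc w (hVP w hw) h]
  have hback : ∀ w ∈ V, w ≠ v → w - v = (c ⬝ᵥ v - c ⬝ᵥ w) • dir w := fun w hw h => by
    rw [hdir, smul_smul, mul_inv_cancel₀ (hpos w hw h).ne', one_smul]
  have hcdir : ∀ w ∈ V, w ≠ v → c ⬝ᵥ dir w = -1 := fun w hw h => by
    have := (hpos w hw h).ne'
    simp only [hdir, dotProduct_smul, dotProduct_sub, smul_eq_mul]
    field_simp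
    ring
  set S : Finset (Fin n → ℝ) := (V.erase v).image dir with hS
  have hSmem : ∀ w ∈ V, w ≠ v → dir w ∈ convexHull ℝ (S : Set (Fin n → ℝ)) := fun w hw h =>
    subset_convexHull ℝ _ (by
      simp only [hS, Finset.coe_image]
      exact ⟨w, by simp [hw, h], rfl⟩)
  obtain ⟨w₁, hw₁, hgw₁⟩ : ∃ w ∈ V, g ⬝ᵥ v < g ⬝ᵥ w := by
    by_contra! h
    exact absurd hg (not_lt.2 (dotProduct_le_of_mem_convexHull (V := (V : Set (Fin n → ℝ)))
      (fun w hw => h w hw) (hV ▸ hx)))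
  have hw₁v : w₁ ≠ v := fun h => by simp [h] at hgw₁
  obtain ⟨q, hq, hqmax⟩ := IsPolytopeHull.exists_vertex_max ⟨S, rfl⟩ ⟨_, hSmem w₁ hw₁ hw₁v⟩ g
  have hqS : q ∈ S := hq.mem_of_convexHull
  obtain ⟨f, hf⟩ := hq.exists_exposing
  have hgq : 0 < g ⬝ᵥ q := by
    refine lt_of_lt_of_le ?_ (hqmax _ (hSmem w₁ hw₁ hw₁v))
    simp only [hdir, dotProduct_smul, dotProduct_sub, smul_eq_mul]
    exact mul_pos (inv_pos.2 (hpos w₁ hw₁ hw₁v)) (by linarith)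
  set h : Fin n → ℝ := f + (f ⬝ᵥ q) • c with hh
  have hheq : ∀ w ∈ V, w ≠ v → h ⬝ᵥ w - h ⬝ᵥ v =
      (c ⬝ᵥ v - c ⬝ᵥ w) * (f ⬝ᵥ dir w - f ⬝ᵥ q) := fun w hw hne => by
    rw [← dotProduct_sub]
    conv_lhs => rw [hback w hw hne]
    simp only [hh, add_dotProduct, smul_dotProduct, dotProduct_smul, smul_eq_mul, hcdir w hw hne]
    ring
  have hle : ∀ w ∈ (V : Set (Fin n → ℝ)), h ⬝ᵥ w ≤ h ⬝ᵥ v := by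
    intro w hw
    by_cases hne : w = v
    · rw [hne]
    have h1 := hheq w hw hne
    have h2 : f ⬝ᵥ dir w ≤ f ⬝ᵥ q := by
      by_cases h3 : dir w = q
      · rw [h3]
      · exact (hf _ (hSmem w hw hne) h3).le
    nlinarith [hpos w hw hne]
  have hray : ∀ w ∈ V, w ≠ v → h ⬝ᵥ w = h ⬝ᵥ v → dir w = q := by
    intro w hw hne heq
    by_contra h3
    have h1 := hheq w hw hne
    have h2 := hf _ (hSmem w hw hne) h3
    nlinarith [hpos w hw hne]
  set R := V.filter (fun w => w ≠ v ∧ dir w = q) with hR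
  obtain ⟨w₂, hw₂⟩ : R.Nonempty := by
    simp only [hS, Finset.mem_image, Finset.mem_erase] at hqS
    obtain ⟨w, hw, hwq⟩ := hqS
    exact ⟨w, by simp [hR, hw.1, hw.2, hwq]⟩
  obtain ⟨w, hwR, hwmax⟩ := R.exists_max_image (fun w => c ⬝ᵥ v - c ⬝ᵥ w) ⟨w₂, hw₂⟩
  obtain ⟨hwV, hwv, hwq⟩ : w ∈ V ∧ w ≠ v ∧ dir w = q := by simpa [hR] using hwR
  have hwτ := hpos w hwV hwv
  have hwb := hback w hwV hwv
  rw [hwq] at hwb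
  have hhw : h ⬝ᵥ w = h ⬝ᵥ v := by
    have := hheq w hwV hwv
    rw [hwq, sub_self, mul_zero] at this
    linarith
  refine ⟨w, hwv, ⟨⟨h, Set.eq_of_subset_of_subset ?_ ?_⟩, v, w, hwv.symm, rfl⟩, ?_⟩
  · rintro y hy
    refine ⟨hconv.segment_subset hvP (hVP w hwV) hy, fun z hz => ?_⟩
    have h1 : h ⬝ᵥ z ≤ h ⬝ᵥ v := dotProduct_le_of_mem_convexHull hle (hV ▸ hz)
    obtain ⟨a, b, ha, hb, hab, rfl⟩ := hy
    simp only [dotR_eq, dotProduct_add, dotProduct_smul, smul_eq_mul, hhw]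
    rw [← add_mul, hab, one_mul]
    exact h1
  · rintro y ⟨hy, hy2⟩
    have h1 := mem_convexHull_of_dotProduct_eq hle (hV ▸ hy)
      (le_antisymm (dotProduct_le_of_mem_convexHull hle (hV ▸ hy)) (hy2 v hvP))
    refine convexHull_min ?_ (convex_segment v w) h1
    rintro z ⟨hz, hz2⟩
    by_cases hzv : z = v
    · rw [hzv]; exact left_mem_segment ℝ v w
    have hzq := hray z hz hzv hz2
    have hzb := hback z hz hzv
    rw [hzq] at hzb
    have hzmax := hwmax z (by simp only [hR, Finset.mem_filter]; exact ⟨hz, hzv, hzq⟩)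
    rw [segment_eq_image']
    refine ⟨(c ⬝ᵥ v - c ⬝ᵥ z) / (c ⬝ᵥ v - c ⬝ᵥ w), ⟨?_, ?_⟩, ?_⟩
    · exact div_nonneg (hpos z hz hzv).le hwτ.le
    · exact (div_le_one hwτ).2 hzmax
    · simp only
      rw [hwb, smul_smul, div_mul_cancel₀ _ hwτ.ne', ← hzb]
      abel
  · have : g ⬝ᵥ (w - v) = (c ⬝ᵥ v - c ⬝ᵥ w) * (g ⬝ᵥ q) := by
      rw [hwb, dotProduct_smul, smul_eq_mul]
    rw [dotProduct_sub] at this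
    nlinarith [mul_pos hwτ hgq]

theorem eq_sum_of_dual {n : ℕ} {R : Type*} [CommRing R] {U d : Fin n → Fin n → R}
    (h : ∀ i j, U i ⬝ᵥ d j = if i = j then -1 else 0) (x : Fin n → R) :
    x = ∑ i, (-(U i ⬝ᵥ x)) • d i := by
  have h1 : Matrix.of U * (-(Matrix.of d).transpose) = 1 := by
    ext i j
    rw [Matrix.mul_neg, Matrix.neg_apply, Matrix.one_apply]
    change -(U i ⬝ᵥ d j) = _
    rw [h]
    split_ifs <;> simp
  have h2 := mul_eq_one_comm.1 h1
  have h3 : (-(Matrix.of d).transpose * Matrix.of U).mulVec x = x := by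
    rw [h2, Matrix.one_mulVec]
  rw [← Matrix.mulVec_mulVec] at h3
  conv_lhs => rw [← h3]
  ext j
  simp [Matrix.mulVec, dotProduct, Finset.sum_apply, mul_comm]

/-- At `v` the convex set `P` looks like a unimodular cone, with integer outer normals `U` and
dual integer edge directions `d`. -/
structure IsUnimodularCorner {n : ℕ} (P : Set (Fin n → ℝ)) (v : Fin n → ℝ) (U d : Fin n → Fin n → ℤ) :
    Prop where
  mem : v ∈ P
  dual : ∀ i j, U i ⬝ᵥ d j = if i = j then -1 else 0
  le : ∀ x ∈ P, ∀ i, intVec (U i) ⬝ᵥ x ≤ intVec (U i) ⬝ᵥ v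
  step : ∀ i, ∃ ε : ℝ, 0 < ε ∧ v + ε • intVec (d i) ∈ P

/-- The points of `P` on the supporting hyperplanes at `v` indexed by `S`. -/
def cornerFace {n : ℕ} (P : Set (Fin n → ℝ)) (U : Fin n → Fin n → ℤ) (v : Fin n → ℝ)
    (S : Finset (Fin n)) : Set (Fin n → ℝ) :=
  {x ∈ P | ∀ i ∈ S, intVec (U i) ⬝ᵥ x = intVec (U i) ⬝ᵥ v}

namespace IsUnimodularCorner

variable {n : ℕ} {P : Set (Fin n → ℝ)} {v : Fin n → ℝ} {U d : Fin n → Fin n → ℤ}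

theorem dual_real (h : IsUnimodularCorner P v U d) (i j : Fin n) :
    intVec (U i) ⬝ᵥ intVec (d j) = if i = j then -1 else 0 := by
  rw [intVec_dotProduct, h.dual]
  split_ifs <;> simp

theorem expand (h : IsUnimodularCorner P v U d) (x : Fin n → ℝ) :
    x = ∑ i, (-(intVec (U i) ⬝ᵥ x)) • intVec (d i) :=
  eq_sum_of_dual h.dual_real x

theorem expand_dual (h : IsUnimodularCorner P v U d) (u : Fin n → ℤ) :
    u = ∑ i, (-(u ⬝ᵥ d i)) • U i := by
  have := eq_sum_of_dual (U := d) (d := U) (fun i j => by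
    rw [dotProduct_comm, h.dual]; simp [eq_comm]) u
  simpa only [dotProduct_comm u] using this

theorem dotProduct_eq_sum (h : IsUnimodularCorner P v U d) (c x : Fin n → ℝ) :
    c ⬝ᵥ x = ∑ i, (-(intVec (U i) ⬝ᵥ x)) * (c ⬝ᵥ intVec (d i)) := by
  conv_lhs => rw [h.expand x]
  simp only [dotProduct_sum, dotProduct_smul, smul_eq_mul]

theorem coord_nonneg (h : IsUnimodularCorner P v U d) {x : Fin n → ℝ} (hx : x ∈ P) (i : Fin n) :
    0 ≤ -(intVec (U i) ⬝ᵥ (x - v)) := by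
  rw [dotProduct_sub]
  linarith [h.le x hx i]

theorem primitive_dir (h : IsUnimodularCorner P v U d) (i : Fin n) : IsPrimitiveZ (d i) := by
  have h1 : Finset.univ.gcd (d i) ∣ U i ⬝ᵥ d i :=
    Finset.dvd_sum fun j hj => Dvd.dvd.mul_left (Finset.gcd_dvd hj) _
  rw [h.dual, if_pos rfl, dvd_neg] at h1
  have h2 := Finset.normalize_gcd (s := Finset.univ) (f := d i)
  unfold IsPrimitiveZ
  rw [← h2]
  exact normalize_eq_one.2 (isUnit_of_dvd_one h1)

theorem primitive_normal (h : IsUnimodularCorner P v U d) (i : Fin n) : IsPrimitiveZ (U i) := by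
  have h1 : Finset.univ.gcd (U i) ∣ U i ⬝ᵥ d i :=
    Finset.dvd_sum fun j hj => Dvd.dvd.mul_right (Finset.gcd_dvd hj) _
  rw [h.dual, if_pos rfl, dvd_neg] at h1
  have h2 := Finset.normalize_gcd (s := Finset.univ) (f := U i)
  unfold IsPrimitiveZ
  rw [← h2]
  exact normalize_eq_one.2 (isUnit_of_dvd_one h1)

theorem dir_mem_cornerFace (h : IsUnimodularCorner P v U d) {i : Fin n} {S : Finset (Fin n)} (hi : i ∉ S)
    {ε : ℝ} (hmem : v + ε • intVec (d i) ∈ P) : v + ε • intVec (d i) ∈ cornerFace P U v S := by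
  refine ⟨hmem, fun j hj => ?_⟩
  rw [dotProduct_add, dotProduct_smul, h.dual_real, if_neg (by rintro rfl; exact hi hj)]
  simp

theorem self_mem_cornerFace (h : IsUnimodularCorner P v U d) (S : Finset (Fin n)) :
    v ∈ cornerFace P U v S :=
  ⟨h.mem, fun _ _ => rfl⟩

theorem cornerFace_subset_iff (h : IsUnimodularCorner P v U d) {S T : Finset (Fin n)} :
    cornerFace P U v S ⊆ cornerFace P U v T ↔ T ⊆ S := by
  constructor
  · intro hST i hi
    by_contra hiS
    obtain ⟨ε, hε, hmem⟩ := h.step i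
    have := (hST (h.dir_mem_cornerFace hiS hmem)).2 i hi
    rw [dotProduct_add, dotProduct_smul, h.dual_real, if_pos rfl, smul_eq_mul] at this
    linarith
  · rintro hTS x ⟨hx, hx2⟩
    exact ⟨hx, fun i hi => hx2 i (hTS hi)⟩

theorem cornerFace_injective (h : IsUnimodularCorner P v U d) :
    Function.Injective (cornerFace P U v) := fun _ _ hST =>
  Finset.Subset.antisymm (h.cornerFace_subset_iff.1 hST.ge) (h.cornerFace_subset_iff.1 hST.le)

theorem isFaceOf_cornerFace (h : IsUnimodularCorner P v U d) (S : Finset (Fin n)) :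
    IsFaceOf P (cornerFace P U v S) := by
  refine ⟨∑ i ∈ S, intVec (U i), Set.eq_of_subset_of_subset ?_ ?_⟩
  · rintro x ⟨hx, hx2⟩
    refine ⟨hx, fun y hy => ?_⟩
    simp only [dotR_eq, sum_dotProduct]
    exact Finset.sum_le_sum fun i hi => (h.le y hy i).trans (hx2 i hi).ge
  · rintro x ⟨hx, hx2⟩
    refine ⟨hx, ?_⟩
    have h1 := hx2 v h.mem
    simp only [dotR_eq, sum_dotProduct] at h1
    have h2 : ∑ i ∈ S, intVec (U i) ⬝ᵥ x = ∑ i ∈ S, intVec (U i) ⬝ᵥ v :=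
      le_antisymm (Finset.sum_le_sum fun i _ => h.le x hx i) h1
    exact (Finset.sum_eq_sum_iff_of_le fun i _ => h.le x hx i).1 h2

/-- The maximizers of a functional that is maximal at the corner. -/
theorem maximizers_eq (h : IsUnimodularCorner P v U d) {c : Fin n → ℝ}
    (hc : ∀ y ∈ P, c ⬝ᵥ y ≤ c ⬝ᵥ v) :
    (∀ i, c ⬝ᵥ intVec (d i) ≤ 0) ∧
    {x ∈ P | ∀ y ∈ P, c ⬝ᵥ y ≤ c ⬝ᵥ x} =
      cornerFace P U v (Finset.univ.filter fun i => c ⬝ᵥ intVec (d i) < 0) := by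
  have hle : ∀ i, c ⬝ᵥ intVec (d i) ≤ 0 := by
    intro i
    obtain ⟨ε, hε, hmem⟩ := h.step i
    have := hc _ hmem
    rw [dotProduct_add, dotProduct_smul, smul_eq_mul] at this
    by_contra! hpos
    nlinarith [mul_pos hε hpos]
  refine ⟨hle, Set.eq_of_subset_of_subset ?_ ?_⟩
  · rintro x ⟨hx, hx2⟩
    refine ⟨hx, fun i hi => ?_⟩
    have h0 : c ⬝ᵥ (x - v) = 0 := by
      rw [dotProduct_sub]
      linarith [hx2 v h.mem, hc x hx]
    rw [h.dotProduct_eq_sum] at h0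
    have h1 := (Finset.sum_eq_zero_iff_of_nonpos (fun j _ =>
      mul_nonpos_of_nonneg_of_nonpos (h.coord_nonneg hx j) (hle j))).1 h0 i (Finset.mem_univ i)
    simp only [Finset.mem_filter, Finset.mem_univ, true_and] at hi
    rcases mul_eq_zero.1 h1 with h2 | h2
    · rw [dotProduct_sub] at h2
      linarith
    · exact absurd h2 hi.ne
  · rintro x ⟨hx, hx2⟩
    refine ⟨hx, fun y hy => (hc y hy).trans ?_⟩
    have h0 : c ⬝ᵥ (x - v) = 0 := by
      rw [h.dotProduct_eq_sum]
      refine Finset.sum_eq_zero fun i _ => ?_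
      by_cases hi : c ⬝ᵥ intVec (d i) < 0
      · rw [dotProduct_sub, hx2 i (by simp [hi])]
        simp
      · rw [le_antisymm (hle i) (not_lt.1 hi), mul_zero]
    rw [dotProduct_sub] at h0
    linarith

theorem exists_eq_cornerFace (h : IsUnimodularCorner P v U d) {G : Set (Fin n → ℝ)} (hG : IsFaceOf P G)
    (hv : v ∈ G) : ∃ S, G = cornerFace P U v S := by
  obtain ⟨c, rfl⟩ := hG
  exact ⟨_, (h.maximizers_eq hv.2).2⟩

theorem linearIndependent_dir (h : IsUnimodularCorner P v U d) :
    LinearIndependent ℝ (fun i => intVec (d i)) := by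
  rw [Fintype.linearIndependent_iff]
  intro g hg i
  have := congrArg (fun x => intVec (U i) ⬝ᵥ x) hg
  simpa [dotProduct_sum, dotProduct_smul, h.dual_real] using this

theorem dimSet_cornerFace (h : IsUnimodularCorner P v U d) (S : Finset (Fin n)) :
    dimSet (cornerFace P U v S) + S.card = n := by
  have h1 : vectorSpan ℝ (cornerFace P U v S) =
      Submodule.span ℝ (Set.range fun i : {i // i ∉ S} => intVec (d i)) := by
    apply le_antisymm
    · rw [vectorSpan_eq_span_vsub_set_right ℝ (h.self_mem_cornerFace S), Submodule.span_le]
      rintro _ ⟨x, hx, rfl⟩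
      simp only [vsub_eq_sub, SetLike.mem_coe]
      rw [h.expand (x - v)]
      refine Submodule.sum_mem _ fun i _ => ?_
      by_cases hi : i ∈ S
      · rw [dotProduct_sub, hx.2 i hi]
        simp
      · exact Submodule.smul_mem _ _ (Submodule.subset_span ⟨⟨i, hi⟩, rfl⟩)
    · rw [Submodule.span_le]
      rintro _ ⟨⟨i, hi⟩, rfl⟩
      obtain ⟨ε, hε, hmem⟩ := h.step i
      have h2 := vsub_mem_vectorSpan ℝ (h.dir_mem_cornerFace hi hmem) (h.self_mem_cornerFace S)
      have h3 := Submodule.smul_mem _ ε⁻¹ h2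
      simpa [smul_smul, inv_mul_cancel₀ hε.ne'] using h3
  have h2 := finrank_span_eq_card
    (h.linearIndependent_dir.comp (Subtype.val : {i // i ∉ S} → Fin n) Subtype.val_injective)
  unfold dimSet
  rw [h1]
  simp only [Function.comp_def] at h2
  rw [h2, Fintype.card_subtype_compl, Fintype.card_coe, Fintype.card_fin]
  have := S.card_le_univ
  rw [Fintype.card_fin] at this
  omega

theorem isFacetOf_cornerFace (h : IsUnimodularCorner P v U d) (i : Fin n) :
    IsFacetOf P (cornerFace P U v {i}) :=
  ⟨h.isFaceOf_cornerFace _, ⟨v, h.self_mem_cornerFace _⟩, h.dimSet_cornerFace {i}⟩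

theorem exists_eq_of_isFacetOf (h : IsUnimodularCorner P v U d) {G : Set (Fin n → ℝ)} (hG : IsFacetOf P G)
    (hv : v ∈ G) : ∃ i, G = cornerFace P U v {i} := by
  obtain ⟨S, rfl⟩ := h.exists_eq_cornerFace hG.1 hv
  have h1 := h.dimSet_cornerFace S
  have h2 := hG.2.2
  obtain ⟨i, rfl⟩ := Finset.card_eq_one.1 (show S.card = 1 by omega)
  exact ⟨i, rfl⟩

theorem maximizers_normal (h : IsUnimodularCorner P v U d) (i : Fin n) :
    {x ∈ P | ∀ y ∈ P, dotZ (U i) y ≤ dotZ (U i) x} = cornerFace P U v {i} := by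
  have h1 := (h.maximizers_eq (c := intVec (U i)) fun y hy => h.le y hy i).2
  have h2 : (Finset.univ.filter fun j => intVec (U i) ⬝ᵥ intVec (d j) < 0) = {i} := by
    ext j
    simp only [h.dual_real, Finset.mem_filter, Finset.mem_univ, true_and, Finset.mem_singleton]
    by_cases hij : i = j
    · simp [hij]
    · simp [hij, Ne.symm hij]
  rw [h2] at h1
  exact h1

theorem isFacetNormal (h : IsUnimodularCorner P v U d) (i : Fin n) :
    IsFacetNormal P (cornerFace P U v {i}) (U i) :=
  ⟨h.primitive_normal i, h.isFacetOf_cornerFace i, (h.maximizers_normal i).symm⟩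

theorem eq_of_isFacetNormal (h : IsUnimodularCorner P v U d) {G : Set (Fin n → ℝ)} {u : Fin n → ℤ}
    (hG : IsFacetNormal P G u) (hv : v ∈ G) : ∃ i, G = cornerFace P U v {i} ∧ u = U i := by
  obtain ⟨hprim, hfacet, hmax⟩ := hG
  obtain ⟨i, hi⟩ := h.exists_eq_of_isFacetOf hfacet hv
  refine ⟨i, hi, ?_⟩
  have hv2 := hv
  rw [hmax] at hv2
  obtain ⟨hle, heq⟩ := h.maximizers_eq (c := intVec u) hv2.2
  have h1 : (Finset.univ.filter fun j => intVec u ⬝ᵥ intVec (d j) < 0) = {i} :=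
    h.cornerFace_injective (by rw [← heq, ← hi]; exact hmax.symm)
  have h2 : ∀ j, intVec u ⬝ᵥ intVec (d j) < 0 ↔ j = i := fun j => by
    have := Finset.ext_iff.1 h1 j
    simpa using this
  have h3 : ∀ j, j ≠ i → u ⬝ᵥ d j = 0 := fun j hj => by
    have := le_antisymm (hle j) (not_lt.1 (mt (h2 j).1 hj))
    rw [intVec_dotProduct] at this
    exact_mod_cast this
  have h4 : u ⬝ᵥ d i < 0 := by
    have := (h2 i).2 rfl
    rw [intVec_dotProduct] at this
    exact_mod_cast this
  have h5 : u = (-(u ⬝ᵥ d i)) • U i := by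
    conv_lhs => rw [h.expand_dual u]
    exact Finset.sum_eq_single i (fun j _ hj => by rw [h3 j hj]; simp) (by simp)
  have h6 : -(u ⬝ᵥ d i) ∣ 1 := by
    rw [← hprim]
    refine Finset.dvd_gcd fun j _ => ⟨U i j, ?_⟩
    have := congrFun h5 j
    simpa using this
  have h7 : -(u ⬝ᵥ d i) = 1 := by
    have := Int.le_of_dvd one_pos h6
    omega
  rw [h7, one_smul] at h5
  exact h5

theorem eq_add_of_mem_cornerFace_erase (h : IsUnimodularCorner P v U d) {i : Fin n} {x : Fin n → ℝ}
    (hx : x ∈ cornerFace P U v (Finset.univ.erase i)) :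
    x = v + (-(intVec (U i) ⬝ᵥ (x - v))) • intVec (d i) := by
  have h1 : x - v = (-(intVec (U i) ⬝ᵥ (x - v))) • intVec (d i) := by
    conv_lhs => rw [h.expand (x - v)]
    refine Finset.sum_eq_single i (fun j _ hj => ?_) (by simp)
    rw [dotProduct_sub, hx.2 j (by simp [hj])]
    simp
  rw [← h1]
  abel

theorem exists_eq_of_isEdgeOf (h : IsUnimodularCorner P v U d) {E : Set (Fin n → ℝ)} (hE : IsEdgeOf P E)
    (hv : v ∈ E) : ∃ i, E = cornerFace P U v (Finset.univ.erase i) := by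
  obtain ⟨hface, a, b, hab, hseg⟩ := hE
  obtain ⟨S, rfl⟩ := h.exists_eq_cornerFace hface hv
  have h1 := h.dimSet_cornerFace S
  have h2 : dimSet (cornerFace P U v S) = 1 := by
    unfold dimSet
    rw [hseg, ← convexHull_pair, ← direction_affineSpan, affineSpan_convexHull,
      direction_affineSpan, vectorSpan_pair]
    exact finrank_span_singleton (sub_ne_zero.2 hab)
  have h3 : Sᶜ.card = 1 := by
    rw [Finset.card_compl, Fintype.card_fin]
    omega
  obtain ⟨i, hi⟩ := Finset.card_eq_one.1 h3
  refine ⟨i, ?_⟩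
  rw [← Finset.compl_singleton, ← hi, compl_compl]

/-- The edges at a corner of a polytope. -/
theorem exists_edge (h : IsUnimodularCorner P v U d) (hP : IsPolytopeHull P) (i : Fin n) :
    ∃ T : ℝ, 0 < T ∧ IsVertexOf P (v + T • intVec (d i)) ∧
      cornerFace P U v (Finset.univ.erase i) = segment ℝ v (v + T • intVec (d i)) := by
  have hface := h.isFaceOf_cornerFace (Finset.univ.erase i)
  obtain ⟨ε, hε, hmem⟩ := h.step i
  have hcpt : IsCompact {t : ℝ | v + t • intVec (d i) ∈ P} := by
    have hcl : IsClosed {t : ℝ | v + t • intVec (d i) ∈ P} :=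
      hP.isCompact.isClosed.preimage (by fun_prop)
    obtain ⟨y, hy, hymin⟩ := hP.isCompact.exists_isMinOn ⟨v, h.mem⟩
      (continuous_const_dotProduct (intVec (U i))).continuousOn
    refine Metric.isCompact_of_isClosed_isBounded hcl
      ((Metric.isBounded_Icc 0 (intVec (U i) ⬝ᵥ v - intVec (U i) ⬝ᵥ y)).subset ?_)
    intro t ht
    have h1 := h.le _ ht i
    have h2 := hymin ht
    simp only [Set.mem_ofPred_eq, dotProduct_add, dotProduct_smul, h.dual_real, if_true,
      smul_eq_mul] at h1 h2
    constructor <;> linarith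
  obtain ⟨T, hT, hTmax⟩ := hcpt.exists_isMaxOn ⟨ε, hmem⟩ continuousOn_id
  have hT0 : 0 < T := hε.trans_le (hTmax hmem)
  have hTf := h.dir_mem_cornerFace (S := Finset.univ.erase i) (by simp) hT
  have hcoord : ∀ y ∈ cornerFace P U v (Finset.univ.erase i), ∃ s, 0 ≤ s ∧ s ≤ T ∧
      y = v + s • intVec (d i) := by
    intro y hy
    have h1 := h.eq_add_of_mem_cornerFace_erase hy
    refine ⟨_, h.coord_nonneg hy.1 i, hTmax ?_, h1⟩
    simp only [Set.mem_ofPred_eq]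
    rw [← h1]
    exact hy.1
  refine ⟨T, hT0, ?_, Set.eq_of_subset_of_subset ?_ ?_⟩
  · apply hP.isVertexOf
    apply hface.isExtreme.extremePoints_subset_extremePoints
    refine ⟨hTf, ?_⟩
    intro y hy z hz hyz
    obtain ⟨s, _, hs, rfl⟩ := hcoord y hy
    obtain ⟨r, _, hr, rfl⟩ := hcoord z hz
    obtain ⟨a, b, ha, hb, hab, heq⟩ := hyz
    have := congrArg (fun x => intVec (U i) ⬝ᵥ x) heq
    simp only [dotProduct_add, dotProduct_smul, h.dual_real, if_true, smul_eq_mul] at this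
    obtain rfl : b = 1 - a := by linarith
    have : s = T := by
      by_contra hne
      have := lt_of_le_of_ne hs hne
      nlinarith
    rw [this]
  · intro y hy
    obtain ⟨s, h0, hs, rfl⟩ := hcoord y hy
    rw [segment_eq_image']
    refine ⟨s / T, ⟨div_nonneg h0 hT0.le, (div_le_one hT0).2 hs⟩, ?_⟩
    simp [smul_smul, div_mul_cancel₀ _ hT0.ne']
  · rintro y ⟨a, b, ha, hb, hab, rfl⟩
    refine ⟨hP.convex h.mem hT ha hb hab, fun j hj => ?_⟩
    rw [dotProduct_add, dotProduct_smul, dotProduct_smul, hTf.2 j hj, ← add_smul, hab, one_smul]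

theorem isUnit_det (h : IsUnimodularCorner P v U d) : IsUnit (Matrix.of d).det := by
  apply Matrix.isUnit_det_of_right_inverse (B := -(Matrix.of U).transpose)
  ext i j
  rw [Matrix.mul_neg, Matrix.neg_apply, Matrix.one_apply]
  change -(d i ⬝ᵥ U j) = _
  rw [dotProduct_comm, h.dual]
  by_cases hij : i = j
  · simp [hij]
  · simp [hij, Ne.symm hij]

theorem isVertexOf (h : IsUnimodularCorner P v U d) : IsVertexOf P v := by
  have h1 := h.isFaceOf_cornerFace Finset.univ
  have h2 : cornerFace P U v Finset.univ = {v} := by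
    refine Set.eq_of_subset_of_subset ?_ ?_
    · intro x hx
      have h3 := h.expand (x - v)
      rw [Finset.sum_eq_zero fun i _ => ?_] at h3
      · exact sub_eq_zero.1 h3
      · rw [dotProduct_sub, hx.2 i (Finset.mem_univ i)]
        simp
    · rintro _ rfl
      exact h.self_mem_cornerFace _
  rwa [h2] at h1

theorem eq_intVec (h : IsUnimodularCorner P v U d) (hv : ∀ i, intVec (U i) ⬝ᵥ v = 1) :
    v = intVec (-∑ i, d i) := by
  conv_lhs => rw [h.expand v]
  simp [hv, intVec_neg, intVec_sum]

theorem smooth_data (h : IsUnimodularCorner P v U d) (hP : IsPolytopeHull P) :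
    (∃ Fs : Fin n → Set (Fin n → ℝ), Function.Injective Fs ∧
      (∀ i, IsFacetOf P (Fs i) ∧ v ∈ Fs i) ∧
      (∀ F, IsFacetOf P F → v ∈ F → ∃ i, F = Fs i)) ∧
    (∃ (E : Fin n → Set (Fin n → ℝ)) (d : Fin n → Fin n → ℤ),
      Function.Injective E ∧
      (∀ i, IsEdgeOf P (E i) ∧ v ∈ E i ∧ EdgeDirAt v (E i) (d i)) ∧
      (∀ E', IsEdgeOf P E' → v ∈ E' → ∃ i, E' = E i) ∧
      IsUnit (Matrix.det (Matrix.of d))) := by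
  refine ⟨⟨fun i => cornerFace P U v {i}, ?_, fun i =>
    ⟨h.isFacetOf_cornerFace i, h.self_mem_cornerFace _⟩, fun G hG hv =>
      h.exists_eq_of_isFacetOf hG hv⟩,
    fun i => cornerFace P U v (Finset.univ.erase i), d, ?_, fun i => ⟨⟨h.isFaceOf_cornerFace _, ?_⟩,
      h.self_mem_cornerFace _, h.primitive_dir i, ?_⟩, fun E hE hv =>
      h.exists_eq_of_isEdgeOf hE hv, h.isUnit_det⟩
  · intro i j hij
    exact Finset.singleton_injective (h.cornerFace_injective hij)
  · intro i j hij
    have h1 := h.cornerFace_injective hij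
    by_contra hne
    have h2 : i ∈ Finset.univ.erase j := by simp [hne]
    rw [← h1] at h2
    simp at h2
  · obtain ⟨T, hT, -, hseg⟩ := h.exists_edge hP i
    refine ⟨_, _, fun heq => ?_, hseg⟩
    have h1 := congrArg (fun x => intVec (U i) ⬝ᵥ x) heq
    simp only [dotProduct_add, dotProduct_smul, h.dual_real, if_true, smul_eq_mul] at h1
    linarith
  · obtain ⟨ε, hε, hmem⟩ := h.step i
    exact ⟨_, h.dir_mem_cornerFace (by simp) hmem, ε, hε, fun j => by simp [intVec]⟩

end IsUnimodularCorner

theorem IsLatticePolytope.isPolytopeHull {n : ℕ} {P : Set (Fin n → ℝ)}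
    (hP : IsLatticePolytope P) : IsPolytopeHull P := by
  obtain ⟨V, -, hV, -⟩ := hP
  exact ⟨V, hV⟩

theorem IsMonotonePolytope.isPolytopeHull {n : ℕ} {P : Set (Fin n → ℝ)}
    (hP : IsMonotonePolytope P) : IsPolytopeHull P :=
  hP.1.isPolytopeHull

theorem IsMonotonePolytope.exists_corner {n : ℕ} {P : Set (Fin n → ℝ)}
    (hP : IsMonotonePolytope P) {v : Fin n → ℝ} (hv : IsVertexOf P v) :
    ∃ U d, IsUnimodularCorner P v U d ∧ ∀ i, intVec (U i) ⬝ᵥ v = 1 := by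
  obtain ⟨-, E, d, -, hE, hE', hdet⟩ := hP.2.1 v hv
  set D : Matrix (Fin n) (Fin n) ℤ := Matrix.of d with hD
  have hdual : ∀ i j, (fun l => -(D⁻¹ l i)) ⬝ᵥ d j = if i = j then -1 else 0 := by
    intro i j
    have h1 : (D * D⁻¹) j i = (1 : Matrix (Fin n) (Fin n) ℤ) j i := by
      rw [Matrix.mul_nonsing_inv _ hdet]
    rw [Matrix.one_apply, Matrix.mul_apply] at h1
    have h2 : (fun l => -(D⁻¹ l i)) ⬝ᵥ d j = -∑ l, D j l * D⁻¹ l i := by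
      simp only [dotProduct, ← Finset.sum_neg_distrib]
      exact Finset.sum_congr rfl fun l _ => by simp only [hD, Matrix.of_apply]; ring
    rw [h2, h1]
    by_cases hij : i = j
    · simp [hij]
    · simp [hij, Ne.symm hij]
  have hcorner : IsUnimodularCorner P v (fun i l => -(D⁻¹ l i)) d := by
    refine ⟨hv.mem, hdual, fun x hx i => ?_, fun i => ?_⟩
    · by_contra! hlt
      obtain ⟨w, hwv, hedge, hgw⟩ := hP.isPolytopeHull.exists_increasing_edge hv hx hlt
      obtain ⟨j, hj⟩ := hE' _ hedge (left_mem_segment ℝ v w)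
      obtain ⟨-, -, -, y, hy, t, ht, hty⟩ := hE j
      rw [← hj, segment_eq_image'] at hy
      obtain ⟨r, ⟨hr0, -⟩, rfl⟩ := hy
      have h1 : r • (w - v) = t • intVec (d j) := by
        ext l
        have := hty l
        simpa [intVec] using this
      have h2 := congrArg (fun x => intVec (fun l => -(D⁻¹ l i)) ⬝ᵥ x) h1
      simp only [dotProduct_smul, dotProduct_sub, intVec_dotProduct, hdual, smul_eq_mul] at h2
      have h3 : 0 < r := by
        refine lt_of_le_of_ne hr0 fun h0 => ?_
        have h4 := congrArg (fun x => intVec (fun l => -(D⁻¹ l j)) ⬝ᵥ x) h1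
        simp only [dotProduct_smul, intVec_dotProduct, hdual, smul_eq_mul, ← h0, if_true] at h4
        simp at h4
        linarith
      split_ifs at h2 <;> push_cast at h2 <;> nlinarith [mul_pos h3 (sub_pos.2 hgw)]
    · obtain ⟨hEi, -, -, y, hy, t, ht, hty⟩ := hE i
      refine ⟨t, ht, ?_⟩
      have : v + t • intVec (d i) = y := by
        ext l
        have := hty l
        simp [intVec]
        linarith
      rw [this]
      exact hEi.1.subset hy
  exact ⟨_, d, hcorner, fun i => hP.2.2.2 _ _ (hcorner.isFacetNormal i) v
    (hcorner.self_mem_cornerFace _)⟩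

theorem IsUnimodularCorner.centralNormal_eq {n : ℕ} {P : Set (Fin n → ℝ)} {v : Fin n → ℝ}
    {U d : Fin n → Fin n → ℤ} (h : IsUnimodularCorner P v U d) {S : Finset (Fin n)}
    {u : Fin n → ℤ} (hu : IsCentralNormal P (cornerFace P U v S) u) : u = ∑ i ∈ S, U i := by
  obtain ⟨m, Fs, us, hinj, hFs, hall, rfl⟩ := hu
  have h1 : ∀ j, ∃ i, Fs j = cornerFace P U v {i} ∧ us j = U i := fun j =>
    h.eq_of_isFacetNormal (hFs j).2 ((hFs j).1 (h.self_mem_cornerFace S))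
  choose σ hσ hσu using h1
  refine Finset.sum_bij (fun j _ => σ j) (fun j _ => ?_) (fun j _ l _ hjl => hinj ?_)
    (fun i hi => ?_) (fun j _ => hσu j)
  · have h2 := (hFs j).1
    rw [hσ j, h.cornerFace_subset_iff] at h2
    simpa using h2
  · rw [hσ j, hσ l, hjl]
  · obtain ⟨j, hj⟩ := hall _ (h.isFacetOf_cornerFace i)
      (h.cornerFace_subset_iff.2 (by simpa using hi))
    refine ⟨j, Finset.mem_univ _, ?_⟩
    rw [hσ j] at hj
    exact (Finset.singleton_injective (h.cornerFace_injective hj)).symm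

theorem IsUnimodularCorner.sum_normal_dotProduct_dir {n : ℕ} {P : Set (Fin n → ℝ)}
    {v : Fin n → ℝ} {U d : Fin n → Fin n → ℤ} (h : IsUnimodularCorner P v U d)
    (S : Finset (Fin n)) (j : Fin n) :
    (∑ i ∈ S, U i) ⬝ᵥ d j = if j ∈ S then -1 else 0 := by
  simp [sum_dotProduct, h.dual]

theorem sum_normal_dotProduct {n : ℕ} {P : Set (Fin n → ℝ)}
    {v : Fin n → ℝ} {U : Fin n → Fin n → ℤ} (hv : ∀ i, intVec (U i) ⬝ᵥ v = 1) {S : Finset (Fin n)} {x : Fin n → ℝ}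
    (hx : x ∈ cornerFace P U v S) :
    intVec (∑ i ∈ S, U i) ⬝ᵥ x = S.card := by
  rw [intVec_sum, sum_dotProduct, Finset.sum_congr rfl hx.2]
  simp [hv]

/-- The local structure of a monotone polytope at a vertex of a face. -/
theorem IsMonotonePolytope.exists_corner_of_mem_face {n k : ℕ} {P F : Set (Fin n → ℝ)}
    (hP : IsMonotonePolytope P) (hF : HasCodim P F k) {u : Fin n → ℤ}
    (hu : IsCentralNormal P F u) {a : Fin n → ℝ} (ha : IsVertexOf P a) (haF : a ∈ F) :
    ∃ U d S, IsUnimodularCorner P a U d ∧ (∀ i, intVec (U i) ⬝ᵥ a = 1) ∧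
      F = cornerFace P U a S ∧ S.card = k ∧ u = ∑ i ∈ S, U i := by
  obtain ⟨U, d, h, h1⟩ := hP.exists_corner ha
  obtain ⟨S, rfl⟩ := h.exists_eq_cornerFace hF.1 haF
  refine ⟨U, d, S, h, h1, rfl, ?_, h.centralNormal_eq hu⟩
  have h2 := h.dimSet_cornerFace S
  have h3 := hF.2.2
  omega

theorem centralNormal_dotProduct_of_mem {n k : ℕ} {P F : Set (Fin n → ℝ)}
    (hP : IsMonotonePolytope P) (hF : HasCodim P F k) {u : Fin n → ℤ}
    (hu : IsCentralNormal P F u) {x : Fin n → ℝ} (hx : x ∈ F) : intVec u ⬝ᵥ x = k := by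
  obtain ⟨a, ha, haF⟩ := hP.isPolytopeHull.exists_vertex_mem_face hF.1 hF.2.1
  obtain ⟨U, d, S, h, h1, rfl, hcard, rfl⟩ := hP.exists_corner_of_mem_face hF hu ha haF
  rw [sum_normal_dotProduct h1 hx, hcard]

theorem primitive_eq_of_smul_eq {n : ℕ} {p q : Fin n → ℤ} {a b : ℤ} (hp : IsPrimitiveZ p)
    (hq : IsPrimitiveZ q) (ha : 0 < a) (hb : 0 ≤ b) (h : a • p = b • q) : a = b := by
  have h1 := congrArg (fun f : Fin n → ℤ => Finset.univ.gcd f) h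
  have h2 : ∀ (c : ℤ) (f : Fin n → ℤ), Finset.univ.gcd (c • f) = normalize c * Finset.univ.gcd f :=
    fun c f => Finset.gcd_mul_left
  simp only [h2] at h1
  rw [hp, hq, Int.normalize_of_nonneg ha.le, Int.normalize_of_nonneg hb] at h1
  simpa using h1

/-- Along an edge leaving the face, the central normal drops by the lattice length. -/
theorem centralNormal_dotProduct_of_edge {n k : ℕ} {P F : Set (Fin n → ℝ)}
    (hP : IsMonotonePolytope P) (hF : HasCodim P F k) {u : Fin n → ℤ}
    (hu : IsCentralNormal P F u) {a b : Fin n → ℝ} {ℓ : ℕ} (ha : IsVertexOf P a)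
    (hedge : IsEdgeOf P (segment ℝ a b)) (haF : a ∈ F) (hbF : b ∉ F)
    (hℓ : LatticeLength a b ℓ) : intVec u ⬝ᵥ b = k - ℓ := by
  have hak := centralNormal_dotProduct_of_mem hP hF hu haF
  obtain ⟨U, d, S, h, h1, rfl, hcard, rfl⟩ := hP.exists_corner_of_mem_face hF hu ha haF
  obtain ⟨i, hi⟩ := h.exists_eq_of_isEdgeOf hedge (left_mem_segment ℝ a b)
  have hb := right_mem_segment ℝ a b
  rw [hi] at hb
  have hbeq := h.eq_add_of_mem_cornerFace_erase hb
  have ht0 := h.coord_nonneg hb.1 i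
  set t := -(intVec (U i) ⬝ᵥ (b - a)) with ht
  have hiS : i ∈ S := by
    by_contra hiS
    exact hbF ⟨hb.1, fun j hj => hb.2 j (by simp; rintro rfl; exact hiS hj)⟩
  have htpos : 0 < t := by
    refine lt_of_le_of_ne ht0 fun h0 => hbF ?_
    rw [← h0] at hbeq
    simpa [hbeq] using haF
  obtain ⟨e, he, heq⟩ := hℓ
  have hba : b - a = (ℓ : ℝ) • intVec e := by
    ext j
    simpa [intVec] using heq j
  have htm : t = ((-(U i ⬝ᵥ e) * ℓ : ℤ) : ℝ) := by
    rw [ht, hba, dotProduct_smul, intVec_dotProduct, smul_eq_mul]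
    push_cast
    ring
  have hpos : 0 < -(U i ⬝ᵥ e) * (ℓ : ℤ) := by
    rw [htm] at htpos
    exact_mod_cast htpos
  have hvec : (-(U i ⬝ᵥ e) * (ℓ : ℤ)) • d i = (ℓ : ℤ) • e := by
    apply intVec_injective
    ext j
    have h2 : b j = a j + t * d i j := by
      conv_lhs => rw [hbeq]
      simp [intVec]
    have h3 := heq j
    rw [h2, htm] at h3
    simp only [intVec, Pi.smul_apply, smul_eq_mul]
    push_cast at h3 ⊢
    linarith
  have hfin := primitive_eq_of_smul_eq (h.primitive_dir i) he hpos (by positivity) hvec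
  rw [hbeq, dotProduct_add, hak, dotProduct_smul, intVec_dotProduct,
    h.sum_normal_dotProduct_dir, if_pos hiS, htm, hfin]
  simp
  ring

/-- The edges at a vertex of a monotone polytope, with their lattice lengths. -/
theorem IsMonotonePolytope.exists_edge_latticeLength {n : ℕ} {P : Set (Fin n → ℝ)}
    (hP : IsMonotonePolytope P) {v : Fin n → ℝ} {U d : Fin n → Fin n → ℤ}
    (h : IsUnimodularCorner P v U d) (hv : ∀ i, intVec (U i) ⬝ᵥ v = 1) (i : Fin n) :
    ∃ ℓ : ℕ, 0 < ℓ ∧ IsVertexOf P (v + (ℓ : ℝ) • intVec (d i)) ∧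
      IsEdgeOf P (segment ℝ v (v + (ℓ : ℝ) • intVec (d i))) ∧
      LatticeLength v (v + (ℓ : ℝ) • intVec (d i)) ℓ ∧
      LatticeLength (v + (ℓ : ℝ) • intVec (d i)) v ℓ := by
  obtain ⟨T, hT, hvert, hseg⟩ := h.exists_edge hP.isPolytopeHull i
  obtain ⟨U', d', h', hv'⟩ := hP.exists_corner hvert
  have h1 := congrArg (fun x => intVec (U i) ⬝ᵥ x) (h'.eq_intVec hv')
  simp only [dotProduct_add, dotProduct_smul, h.dual_real, if_true, smul_eq_mul, hv,
    intVec_dotProduct] at h1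
  set m := U i ⬝ᵥ (-∑ i, d' i)
  have hTm : T = ((1 - m : ℤ) : ℝ) := by
    push_cast
    linarith
  have hm : 0 < 1 - m := by
    rw [hTm] at hT
    exact_mod_cast hT
  obtain ⟨ℓ, hℓ⟩ := Int.eq_ofNat_of_zero_le hm.le
  have hTℓ : T = (ℓ : ℝ) := by
    rw [hTm, hℓ]
    simp
  subst hTℓ
  refine ⟨ℓ, by exact_mod_cast hT, hvert, ⟨hseg ▸ h.isFaceOf_cornerFace _, v, _, fun heq => ?_, rfl⟩,
    ⟨d i, h.primitive_dir i, fun j => by simp [intVec]⟩, ⟨-d i, ?_, fun j => by simp [intVec]⟩⟩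
  · have h1 := congrArg (fun x => intVec (U i) ⬝ᵥ x) heq
    simp only [dotProduct_add, dotProduct_smul, h.dual_real, if_true, smul_eq_mul] at h1
    linarith
  · have h2 := h.primitive_dir i
    unfold IsPrimitiveZ at h2 ⊢
    have h3 : Finset.univ.gcd (fun j => -1 * d i j) = normalize (-1) * Finset.univ.gcd (d i) :=
      Finset.gcd_mul_left
    have h4 : (-d i) = fun j => -1 * d i j := by ext; simp
    rw [h4, h3, h2, mul_one]
    exact normalize_eq_one.2 (by simp)

/-- Every edge of `P` leaving the face `F` has lattice length at least `k`. -/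
def LongEdgesFrom {n : ℕ} (P F : Set (Fin n → ℝ)) (k : ℕ) : Prop :=
  ∀ a b ℓ, IsVertexOf P a → IsVertexOf P b → IsEdgeOf P (segment ℝ a b) → a ∈ F → b ∉ F →
    LatticeLength a b ℓ → k ≤ ℓ

section

variable {n k : ℕ} {P F : Set (Fin n → ℝ)} {u : Fin n → ℤ}

theorem LongEdgesFrom.step_mem (hlong : LongEdgesFrom P F k) (hP : IsMonotonePolytope P)
    {a : Fin n → ℝ} {U d : Fin n → Fin n → ℤ} {S : Finset (Fin n)}
    (h : IsUnimodularCorner P a U d) (hv : ∀ i, intVec (U i) ⬝ᵥ a = 1)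
    (hF : F = cornerFace P U a S) {i : Fin n} (hi : i ∈ S) :
    a + (k : ℝ) • intVec (d i) ∈ P := by
  obtain ⟨ℓ, hℓ, hvert, hedge, hlen, -⟩ := hP.exists_edge_latticeLength h hv i
  have hℓ0 : (0 : ℝ) < ℓ := by exact_mod_cast hℓ
  have hkℓ : k ≤ ℓ := by
    refine hlong _ _ ℓ h.isVertexOf hvert hedge (hF ▸ h.self_mem_cornerFace S) ?_ hlen
    rw [hF]
    rintro ⟨-, hmem⟩
    have := hmem i hi
    simp only [dotProduct_add, dotProduct_smul, h.dual_real, if_true, smul_eq_mul] at this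
    linarith
  have hseg := hP.isPolytopeHull.convex.segment_subset h.mem hvert.mem
  apply hseg
  rw [segment_eq_image']
  refine ⟨(k : ℝ) / ℓ, ⟨by positivity, (div_le_one hℓ0).2 (by exact_mod_cast hkℓ)⟩, ?_⟩
  simp [smul_smul, div_mul_cancel₀ _ hℓ0.ne']

theorem LongEdgesFrom.dotZ_nonpos (hlong : LongEdgesFrom P F k) (hP : IsMonotonePolytope P)
    (hF : HasCodim P F k) (hu : IsCentralNormal P F u) {v : Fin n → ℝ} (hv : IsVertexOf P v)
    (hvF : v ∉ F) : dotZ u v ≤ 0 := by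
  rw [dotZ_eq]
  by_contra! hpos
  have hfin : {w | IsVertexOf P w ∧ w ∉ F}.Finite :=
    hP.isPolytopeHull.finite_vertices.subset fun w hw => hw.1
  obtain ⟨w, ⟨hw, hwF⟩, hmax⟩ := Set.exists_max_image _ (fun w => intVec u ⬝ᵥ w) hfin
    ⟨v, hv, hvF⟩
  have hwpos : 0 < intVec u ⬝ᵥ w := hpos.trans_le (hmax v ⟨hv, hvF⟩)
  obtain ⟨U, d, h, h1⟩ := hP.exists_corner hw
  have hup : ∃ i, 0 < intVec u ⬝ᵥ intVec (d i) := by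
    by_contra! hle
    obtain ⟨f, hf⟩ := hF.2.1
    have hfP := hF.1.subset hf
    have hlt : intVec u ⬝ᵥ w < intVec u ⬝ᵥ f := by
      rw [centralNormal_dotProduct_of_mem hP hF hu hf]
      obtain ⟨a, ha, haF⟩ := hP.isPolytopeHull.exists_vertex_mem_face hF.1 hF.2.1
      obtain ⟨U', d', S, h', h1', rfl, hcard, rfl⟩ := hP.exists_corner_of_mem_face hF hu ha haF
      by_contra! hge
      apply hwF
      have h3 : ∀ i ∈ S, intVec (U' i) ⬝ᵥ w ≤ 1 := fun i _ => by
        rw [← h1' i]; exact h'.le w hw.mem i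
      have h4 : ∑ i ∈ S, intVec (U' i) ⬝ᵥ w = ∑ i ∈ S, (1 : ℝ) := by
        refine le_antisymm (Finset.sum_le_sum h3) ?_
        rw [intVec_sum, sum_dotProduct] at hge
        simpa [hcard] using hge
      refine ⟨hw.mem, fun i hi => ?_⟩
      rw [h1']
      exact (Finset.sum_eq_sum_iff_of_le h3).1 h4 i hi
    have h2 : intVec u ⬝ᵥ (f - w) ≤ 0 := by
      rw [h.dotProduct_eq_sum]
      exact Finset.sum_nonpos fun i _ =>
        mul_nonpos_of_nonneg_of_nonpos (h.coord_nonneg hfP i) (hle i)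
    rw [dotProduct_sub] at h2
    linarith
  obtain ⟨i, hi⟩ := hup
  obtain ⟨ℓ, hℓ, hvert, hedge, -, hlen⟩ := hP.exists_edge_latticeLength h h1 i
  have hℓ0 : (0 : ℝ) < ℓ := by exact_mod_cast hℓ
  have hlt : intVec u ⬝ᵥ w < intVec u ⬝ᵥ (w + (ℓ : ℝ) • intVec (d i)) := by
    rw [dotProduct_add, dotProduct_smul, smul_eq_mul]
    nlinarith [mul_pos hℓ0 hi]
  have hF' : w + (ℓ : ℝ) • intVec (d i) ∈ F := by
    by_contra hnF
    exact absurd (hmax _ ⟨hvert, hnF⟩) (not_le.2 hlt)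
  rw [segment_symm] at hedge
  have hkℓ : (k : ℝ) ≤ ℓ := by exact_mod_cast hlong _ _ ℓ hvert hw hedge hF' hwF hlen
  have := centralNormal_dotProduct_of_edge hP hF hu hvert hedge hF' hwF hlen
  linarith

theorem convex_blowupSet (hP : Convex ℝ P) : Convex ℝ (blowupSet P u) := by
  rw [convex_iff_forall_pos]
  rintro x ⟨hx, hx2⟩ y ⟨hy, hy2⟩ a b ha hb hab
  refine ⟨hP hx hy ha.le hb.le hab, ?_⟩
  rw [dotZ_eq] at *
  rw [dotProduct_add, dotProduct_smul, dotProduct_smul, smul_eq_mul, smul_eq_mul]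
  obtain rfl : b = 1 - a := by linarith
  nlinarith

/-- A corner of `P` strictly below the cut is a corner of the blow-up. -/
theorem IsUnimodularCorner.blowup_of_lt {v : Fin n → ℝ} {U d : Fin n → Fin n → ℤ}
    (h : IsUnimodularCorner P v U d) (hP : Convex ℝ P) (hv : dotZ u v < 1) :
    IsUnimodularCorner (blowupSet P u) v U d := by
  refine ⟨⟨h.mem, hv.le⟩, h.dual, fun x hx i => h.le x hx.1 i, fun i => ?_⟩
  obtain ⟨ε, hε, hmem⟩ := h.step i
  rw [dotZ_eq] at hv
  set s := |intVec u ⬝ᵥ intVec (d i)| with hs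
  have hs0 : 0 ≤ s := abs_nonneg _
  have hden : 0 < ε * s + (1 - intVec u ⬝ᵥ v) := by nlinarith
  set r := (1 - intVec u ⬝ᵥ v) / (ε * s + (1 - intVec u ⬝ᵥ v)) with hr
  have hr0 : 0 < r := div_pos (by linarith) hden
  have hr1 : r ≤ 1 := (div_le_one hden).2 (by nlinarith)
  have hrs : r * (ε * s) ≤ 1 - intVec u ⬝ᵥ v := by
    have : r * (ε * s + (1 - intVec u ⬝ᵥ v)) = 1 - intVec u ⬝ᵥ v := div_mul_cancel₀ _ hden.ne'
    nlinarith [mul_pos hr0 (sub_pos.2 hv)]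
  refine ⟨r * ε, mul_pos hr0 hε, ?_, ?_⟩
  · apply hP.segment_subset h.mem hmem
    rw [segment_eq_image']
    exact ⟨r, ⟨hr0.le, hr1⟩, by simp [smul_smul]⟩
  · rw [dotZ_eq, dotProduct_add, dotProduct_smul, smul_eq_mul]
    have h1 : intVec u ⬝ᵥ intVec (d i) ≤ s := le_abs_self _
    nlinarith [mul_pos hr0 hε]

/-- The corner of the blow-up on an edge leaving the face. -/
theorem LongEdgesFrom.blowup_corner (hlong : LongEdgesFrom P F k) (hk : 2 ≤ k)
    (hP : IsMonotonePolytope P)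
    {a : Fin n → ℝ} {U d : Fin n → Fin n → ℤ} {S : Finset (Fin n)}
    (h : IsUnimodularCorner P a U d) (hv : ∀ i, intVec (U i) ⬝ᵥ a = 1)
    (hF : F = cornerFace P U a S) (hcard : S.card = k) (hu : u = ∑ i ∈ S, U i)
    {i : Fin n} (hi : i ∈ S) :
    ∃ d', IsUnimodularCorner (blowupSet P u) (a + ((k : ℝ) - 1) • intVec (d i))
      (Function.update U i u) d' ∧
      ∀ j, intVec (Function.update U i u j) ⬝ᵥ (a + ((k : ℝ) - 1) • intVec (d i)) = 1 := by
  have hk1 : (2 : ℝ) ≤ k := by exact_mod_cast hk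
  have hconv := hP.isPolytopeHull.convex
  have hstep : ∀ j ∈ S, ∀ t : ℝ, 0 ≤ t → t ≤ k → a + t • intVec (d j) ∈ P := by
    intro j hj t ht0 htk
    apply hconv.segment_subset h.mem (hlong.step_mem hP h hv hF hj)
    rw [segment_eq_image']
    refine ⟨t / k, ⟨by positivity, (div_le_one (by linarith)).2 htk⟩, ?_⟩
    have : (k : ℝ) ≠ 0 := by linarith
    simp [smul_smul, div_mul_cancel₀ _ this]
  have hud : ∀ j, u ⬝ᵥ d j = if j ∈ S then -1 else 0 := fun j => by
    rw [hu]; exact h.sum_normal_dotProduct_dir S j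
  have hudr : ∀ j, intVec u ⬝ᵥ intVec (d j) = if j ∈ S then -1 else 0 := fun j => by
    rw [intVec_dotProduct, hud]; split_ifs <;> simp
  have hua : intVec u ⬝ᵥ a = k := by
    rw [hu, sum_normal_dotProduct hv (h.self_mem_cornerFace S), hcard]
  set z := a + ((k : ℝ) - 1) • intVec (d i) with hz
  have huz : intVec u ⬝ᵥ z = 1 := by
    rw [hz, dotProduct_add, dotProduct_smul, hudr, if_pos hi, hua, smul_eq_mul]
    ring
  have hUz : ∀ j, j ≠ i → intVec (U j) ⬝ᵥ z = 1 := fun j hj => by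
    rw [hz, dotProduct_add, dotProduct_smul, h.dual_real, if_neg hj, hv]
    simp
  have hone : ∀ j, intVec (Function.update U i u j) ⬝ᵥ z = 1 := by
    intro j
    by_cases hj : j = i
    · subst hj; rw [Function.update_self]; exact huz
    · rw [Function.update_of_ne hj]; exact hUz j hj
  refine ⟨fun j => if j = i then d i else if j ∈ S then d j - d i else d j,
    ⟨⟨hstep i hi _ (by linarith) (by linarith), huz.le⟩, ?_, ?_, ?_⟩, hone⟩
  · intro j l
    by_cases hj : j = i
    · subst hj
      rw [Function.update_self]
      by_cases hl : l = j
      · subst hl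
        simp [hud, hi]
      · by_cases hlS : l ∈ S
        · simp [hl, Ne.symm hl, hlS, dotProduct_sub, hud, hi]
        · simp [hl, Ne.symm hl, hlS, hud]
    · rw [Function.update_of_ne hj]
      by_cases hl : l = i
      · subst hl
        simp [h.dual, hj]
      · by_cases hlS : l ∈ S
        · simp [hl, hlS, dotProduct_sub, h.dual, hj]
        · simp [hl, hlS, h.dual]
  · intro x hx j
    rw [hone]
    by_cases hj : j = i
    · subst hj
      rw [Function.update_self]
      exact hx.2
    · rw [Function.update_of_ne hj, ← hv j]
      exact h.le x hx.1 j
  · intro j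
    by_cases hj : j = i
    · subst hj
      refine ⟨1, one_pos, ?_, ?_⟩
      · simp only [if_true]
        rw [hz, add_assoc, ← add_smul]
        exact hstep j hi _ (by linarith) (by linarith)
      · simp only [if_true]
        rw [dotZ_eq, dotProduct_add, huz, dotProduct_smul, hudr, if_pos hi]
        norm_num
    · by_cases hjS : j ∈ S
      · simp only [hj, hjS, if_true, if_false]
        refine ⟨(k : ℝ) - 1, by linarith, ?_, ?_⟩
        · have : z + ((k : ℝ) - 1) • intVec (d j - d i) = a + ((k : ℝ) - 1) • intVec (d j) := by
            rw [hz, intVec_sub, smul_sub]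
            abel
          rw [this]
          exact hstep j hjS _ (by linarith) (by linarith)
        · rw [dotZ_eq, dotProduct_add, huz, dotProduct_smul, intVec_sub, dotProduct_sub, hudr, hudr,
            if_pos hi, if_pos hjS]
          simp
      · simp only [hj, hjS, if_false]
        obtain ⟨ε, hε, hmem⟩ := h.step j
        have hk0 : (0 : ℝ) < k := by linarith
        refine ⟨ε / k, by positivity, ?_, ?_⟩
        · have h2 := hconv (hlong.step_mem hP h hv hF hi) hmem
            (a := ((k : ℝ) - 1) / k) (b := 1 / k) (by apply div_nonneg <;> linarith)
            (by positivity) (by field_simp; ring)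
          have h3 : z + (ε / k) • intVec (d j) =
              (((k : ℝ) - 1) / k) • (a + (k : ℝ) • intVec (d i)) +
              (1 / (k : ℝ)) • (a + ε • intVec (d j)) := by
            rw [hz]
            ext l
            simp only [Pi.add_apply, Pi.smul_apply, smul_eq_mul]
            field_simp
            ring
          rw [h3]
          exact h2
        · rw [dotZ_eq, dotProduct_add, huz, dotProduct_smul, hudr, if_neg hjS]
          simp

/-- The blow-up is the convex hull of finitely many points, each of them a unimodular corner on
all of whose supporting hyperplanes the normals take the value `1`. -/
theorem LongEdgesFrom.exists_blowup_hull (hlong : LongEdgesFrom P F k) (hk : 2 ≤ k)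
    (hP : IsMonotonePolytope P) (hF : HasCodim P F k) (hu : IsCentralNormal P F u) :
    ∃ W : Finset (Fin n → ℝ), blowupSet P u = convexHull ℝ (W : Set (Fin n → ℝ)) ∧
      ∀ z ∈ W, ∃ U d, IsUnimodularCorner (blowupSet P u) z U d ∧
        ∀ i, intVec (U i) ⬝ᵥ z = 1 := by
  have hhull := hP.isPolytopeHull
  have hk1 : (2 : ℝ) ≤ k := by exact_mod_cast hk
  set Vt := {v | IsVertexOf P v} with hVt
  have hVfin : Vt.Finite := hhull.finite_vertices
  set W : Set (Fin n → ℝ) := {z | z ∈ Vt ∪ Set.image2 (fun a b =>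
    a + (((k : ℝ) - 1) / (k - intVec u ⬝ᵥ b)) • (b - a)) Vt Vt ∧
      ∃ U d, IsUnimodularCorner (blowupSet P u) z U d ∧ ∀ i, intVec (U i) ⬝ᵥ z = 1} with hW
  have hWfin : W.Finite := (hVfin.union (hVfin.image2 _ hVfin)).subset fun z hz => hz.1
  have hWB : ∀ z ∈ W, z ∈ blowupSet P u := by
    rintro z ⟨-, U, d, h, -⟩
    exact h.mem
  have hnp : ∀ v, IsVertexOf P v → v ∉ F → intVec u ⬝ᵥ v ≤ 0 := fun v hv hvF =>
    hlong.dotZ_nonpos hP hF hu hv hvF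
  have huF : ∀ x ∈ F, intVec u ⬝ᵥ x = k := fun x hx =>
    centralNormal_dotProduct_of_mem hP hF hu hx
  have hWold : ∀ v, IsVertexOf P v → v ∉ F → v ∈ W := by
    intro v hv hvF
    obtain ⟨U, d, h, h1⟩ := hP.exists_corner hv
    exact ⟨Or.inl hv, U, d, h.blowup_of_lt hhull.convex
      (lt_of_le_of_lt (hnp v hv hvF) one_pos), h1⟩
  have hWnew : ∀ {a : Fin n → ℝ} {U d : Fin n → Fin n → ℤ} {S : Finset (Fin n)},
      IsUnimodularCorner P a U d → (∀ i, intVec (U i) ⬝ᵥ a = 1) → F = cornerFace P U a S →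
      S.card = k → u = ∑ i ∈ S, U i → ∀ i ∈ S, a + ((k : ℝ) - 1) • intVec (d i) ∈ W := by
    intro a U d S h h1 hFS hcard huS i hi
    obtain ⟨d', hd', hone⟩ := hlong.blowup_corner hk hP h h1 hFS hcard huS hi
    refine ⟨Or.inr ?_, _, d', hd', hone⟩
    obtain ⟨ℓ, hℓ, hvert, hedge, hlen, -⟩ := hP.exists_edge_latticeLength h h1 i
    have hℓ0 : (0 : ℝ) < ℓ := by exact_mod_cast hℓ
    refine ⟨a, h.isVertexOf, _, hvert, ?_⟩
    have hub : intVec u ⬝ᵥ (a + (ℓ : ℝ) • intVec (d i)) = k - ℓ := by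
      rw [dotProduct_add, huF a (hFS ▸ h.self_mem_cornerFace S), dotProduct_smul,
        intVec_dotProduct, huS, h.sum_normal_dotProduct_dir, if_pos hi]
      simp
      ring
    simp only [hub]
    rw [sub_sub_cancel, add_sub_cancel_left, smul_smul, div_mul_cancel₀ _ hℓ0.ne']
  refine ⟨hWfin.toFinset, ?_, fun z hz => (hWfin.mem_toFinset.1 hz).2⟩
  rw [hWfin.coe_toFinset]
  refine Set.eq_of_subset_of_subset ?_ (convexHull_min hWB (convex_blowupSet hhull.convex))
  intro x hx
  by_contra hxW
  obtain ⟨c, hc⟩ := exists_dotProduct_lt (convex_convexHull ℝ W)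
    (hWfin.isCompact_convexHull ℝ).isClosed hxW
  replace hc : ∀ y ∈ W, c ⬝ᵥ y < c ⬝ᵥ x := fun y hy => hc y (subset_convexHull ℝ W hy)
  obtain ⟨a₀, ha₀, ha₀F⟩ := hhull.exists_vertex_mem_face hF.1 hF.2.1
  obtain ⟨a, ⟨ha, haF⟩, hamax⟩ := Set.exists_max_image {v | IsVertexOf P v ∧ v ∈ F}
    (fun v => c ⬝ᵥ v) (hVfin.subset fun v hv => hv.1) ⟨a₀, ha₀, ha₀F⟩
  have hlt : ∀ v, IsVertexOf P v → v ∉ F → c ⬝ᵥ v < c ⬝ᵥ a := by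
    by_contra! hex
    obtain ⟨v, hv, hvF, hav⟩ := hex
    obtain ⟨m, hm, hmmax⟩ := hhull.exists_vertex_max ⟨v, hv.mem⟩ c
    have h1 := hmmax x hx.1
    by_cases hmF : m ∈ F
    · have h2 := hamax m ⟨hm, hmF⟩
      have h3 := hc v (hWold v hv hvF)
      linarith
    · exact absurd (hc m (hWold m hm hmF)) (not_lt.2 h1)
  have hN : ∃ v, IsVertexOf P v ∧ v ∉ F := by
    by_contra! hall
    have h0 : (0 : Fin n → ℝ) ∈ P := interior_subset hP.2.2.1
    have := hhull.dotProduct_le (c := -intVec u) (m := -(k : ℝ))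
      (fun v hv => by rw [neg_dotProduct, huF v (hall v hv)]) h0
    rw [dotProduct_zero] at this
    linarith
  obtain ⟨b, ⟨hb, hbF⟩, hbmin⟩ := Set.exists_min_image {v | IsVertexOf P v ∧ v ∉ F}
    (fun v => (c ⬝ᵥ a - c ⬝ᵥ v) / (k - intVec u ⬝ᵥ v)) (hVfin.subset fun v hv => hv.1) hN
  set μ := (c ⬝ᵥ a - c ⬝ᵥ b) / (k - intVec u ⬝ᵥ b) with hμ
  have hden : ∀ v, IsVertexOf P v → v ∉ F → 0 < (k : ℝ) - intVec u ⬝ᵥ v := fun v hv hvF => by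
    linarith [hnp v hv hvF]
  have hμ0 : 0 < μ := div_pos (by linarith [hlt b hb hbF]) (hden b hb hbF)
  set g := c - μ • intVec u with hg
  have hgx : ∀ y, g ⬝ᵥ y = c ⬝ᵥ y - μ * (intVec u ⬝ᵥ y) := fun y => by
    rw [hg, sub_dotProduct, smul_dotProduct, smul_eq_mul]
  have hgmax : ∀ y ∈ P, g ⬝ᵥ y ≤ g ⬝ᵥ a := by
    intro y hy
    refine hhull.dotProduct_le (fun v hv => ?_) hy
    rw [hgx, hgx, huF a haF]
    by_cases hvF : v ∈ F
    · have h2 := hamax v ⟨hv, hvF⟩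
      rw [huF v hvF]
      linarith
    · have h2 := hbmin v ⟨hv, hvF⟩
      rw [le_div_iff₀ (hden v hv hvF)] at h2
      linarith
  have hgb : g ⬝ᵥ b = g ⬝ᵥ a := by
    have h2 : μ * (k - intVec u ⬝ᵥ b) = c ⬝ᵥ a - c ⬝ᵥ b :=
      div_mul_cancel₀ _ (hden b hb hbF).ne'
    rw [hgx, hgx, huF a haF]
    linarith
  obtain ⟨U, d, S, h, h1, hFS, hcard, huS⟩ := hP.exists_corner_of_mem_face hF hu ha haF
  obtain ⟨hgd, hface⟩ := h.maximizers_eq hgmax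
  have hbface : b ∈ {x ∈ P | ∀ y ∈ P, g ⬝ᵥ y ≤ g ⬝ᵥ x} :=
    ⟨hb.mem, fun y hy => (hgmax y hy).trans hgb.ge⟩
  rw [hface] at hbface
  obtain ⟨i, hiS, hi⟩ : ∃ i ∈ S, intVec (U i) ⬝ᵥ b ≠ intVec (U i) ⬝ᵥ a := by
    by_contra! hall
    exact hbF (hFS ▸ ⟨hb.mem, hall⟩)
  have hgi : g ⬝ᵥ intVec (d i) = 0 := by
    refine le_antisymm (hgd i) (not_lt.1 fun hneg => hi (hbface.2 i ?_))
    simpa using hneg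
  have hcz := hc _ (hWnew h h1 hFS hcard huS i hiS)
  have hgz : g ⬝ᵥ (a + ((k : ℝ) - 1) • intVec (d i)) = g ⬝ᵥ a := by
    rw [dotProduct_add, dotProduct_smul, hgi]
    simp
  have huz : intVec u ⬝ᵥ (a + ((k : ℝ) - 1) • intVec (d i)) = 1 := by
    rw [dotProduct_add, dotProduct_smul, huF a haF, intVec_dotProduct, huS,
      h.sum_normal_dotProduct_dir, if_pos hiS]
    simp
  have h2 := hgmax x hx.1
  rw [← hgz, hgx, hgx, huz] at h2
  have h3 : intVec u ⬝ᵥ x ≤ 1 := hx.2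
  nlinarith

theorem zero_mem_interior_blowupSet (h0 : (0 : Fin n → ℝ) ∈ interior P) :
    (0 : Fin n → ℝ) ∈ interior (blowupSet P u) := by
  have hopen : IsOpen {x : Fin n → ℝ | intVec u ⬝ᵥ x < 1} :=
    isOpen_lt (continuous_const_dotProduct _) continuous_const
  refine mem_interior.2 ⟨interior P ∩ {x | intVec u ⬝ᵥ x < 1}, ?_, isOpen_interior.inter hopen, h0,
    by simp⟩
  rintro x ⟨hx, hx2⟩
  exact ⟨interior_subset hx, le_of_lt hx2⟩

theorem LongEdgesFrom.isMonotonePolytope_blowupSet (hlong : LongEdgesFrom P F k) (hk : 2 ≤ k)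
    (hP : IsMonotonePolytope P) (hF : HasCodim P F k) (hu : IsCentralNormal P F u) :
    IsMonotonePolytope (blowupSet P u) := by
  obtain ⟨W, hW, hcorner⟩ := hlong.exists_blowup_hull hk hP hF hu
  have hhull : IsPolytopeHull (blowupSet P u) := ⟨W, hW⟩
  have hvert : ∀ v, IsVertexOf (blowupSet P u) v → v ∈ W := by
    intro v hv
    rw [hW] at hv
    exact hv.mem_of_convexHull
  have h0 := zero_mem_interior_blowupSet (u := u) hP.2.2.1
  refine ⟨⟨W, fun v hv => ?_, hW, ?_⟩, fun v hv => ?_, h0, fun G w hG x hx => ?_⟩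
  · obtain ⟨U, d, h, h1⟩ := hcorner v hv
    intro i
    exact ⟨_, congrFun (h.eq_intVec h1) i⟩
  · exact hhull.convex.interior_nonempty_iff_affineSpan_eq_top.1 ⟨0, h0⟩
  · obtain ⟨U, d, h, -⟩ := hcorner v (hvert v hv)
    exact h.smooth_data hhull
  · obtain ⟨v, hv, hvG⟩ := hhull.exists_vertex_mem_face hG.2.1.1 hG.2.1.2.1
    obtain ⟨U, d, h, h1⟩ := hcorner v (hvert v hv)
    obtain ⟨i, rfl, rfl⟩ := h.eq_of_isFacetNormal hG hvG
    rw [dotZ_eq, hx.2 i (by simp), h1]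

theorem LongEdgesFrom.isFacetOf_blowupSet (hlong : LongEdgesFrom P F k) (hk : 2 ≤ k)
    (hP : IsMonotonePolytope P) (hF : HasCodim P F k) (hu : IsCentralNormal P F u) :
    IsFacetOf (blowupSet P u) {x ∈ blowupSet P u | dotZ u x = 1} := by
  obtain ⟨a, ha, haF⟩ := hP.isPolytopeHull.exists_vertex_mem_face hF.1 hF.2.1
  obtain ⟨U, d, S, h, h1, hFS, hcard, huS⟩ := hP.exists_corner_of_mem_face hF hu ha haF
  obtain ⟨i, hi⟩ : S.Nonempty := Finset.card_pos.1 (by omega)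
  obtain ⟨d', h', hone⟩ := hlong.blowup_corner hk hP h h1 hFS hcard huS hi
  have h2 := h'.isFacetOf_cornerFace i
  have h3 := hone i
  rw [Function.update_self] at h3
  have h4 : {x ∈ blowupSet P u | dotZ u x = 1} = cornerFace (blowupSet P u)
      (Function.update U i u) (a + ((k : ℝ) - 1) • intVec (d i)) {i} := by
    ext x
    simp only [cornerFace, Set.mem_ofPred_eq, Finset.mem_singleton, forall_eq, Function.update_self,
      h3, dotZ_eq]
  rwa [h4]

theorem AdmitsMonotoneBlowup.longEdgesFrom (hadm : AdmitsMonotoneBlowup P F u)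
    (hP : IsMonotonePolytope P) (hF : HasCodim P F k) : LongEdgesFrom P F k := by
  intro a b ℓ ha hb hedge haF hbF hℓ
  have h1 := hadm.2.1 b hb hbF
  rw [dotZ_eq, centralNormal_dotProduct_of_edge hP hF hadm.1 ha hedge haF hbF hℓ] at h1
  have : (k : ℝ) ≤ ℓ := by linarith
  exact_mod_cast this

end

/-- Lemma 3.10: for a face `F` of codimension `k ≥ 2` of a
monotone polytope `P`, the monotone blow-up at `F` is admissible iff every edge
of `P` with exactly one endpoint in `F` has lattice length at least `k`;
moreover the new facet created lies in the hyperplane `{x : u_F · x = 1}`. -/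
theorem monotone_blowup_iff_edge_lengths {n k : ℕ} (hk : 2 ≤ k)
    (P F : Set (Fin n → ℝ)) (hP : IsMonotonePolytope P) (hF : HasCodim P F k)
    (u : Fin n → ℤ) (hu : IsCentralNormal P F u) :
    (AdmitsMonotoneBlowup P F u ↔
      ∀ a b ℓ, IsVertexOf P a → IsVertexOf P b →
        IsEdgeOf P (segment ℝ a b) → a ∈ F → b ∉ F →
        LatticeLength a b ℓ → k ≤ ℓ) ∧
    (AdmitsMonotoneBlowup P F u →
      IsFacetOf (blowupSet P u) {x ∈ blowupSet P u | dotZ u x = 1}) := by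
  have hfwd : AdmitsMonotoneBlowup P F u → LongEdgesFrom P F k := fun h => h.longEdgesFrom hP hF
  exact ⟨⟨hfwd, fun h => ⟨hu, fun _ hv hvF => LongEdgesFrom.dotZ_nonpos h hP hF hu hv hvF,
    LongEdgesFrom.isMonotonePolytope_blowupSet h hk hP hF hu⟩⟩,
    fun h => (hfwd h).isFacetOf_blowupSet hk hP hF hu⟩
end

section
/- Let P ⊆ ℝ^n be a monotone polytope with vertex v = −(1,…,1) whose n incident facets are supported on the hyperplanes {x : x_i = −1}, so that the edges of P incident to v go in the positive coordinate directions and the neighbors of v are v_i = −(1,…,1) + ℓ_i e_i where ℓ_i is the lattice length of the edge v v_i. Suppose ℓ_i ≥ n for all i. For each i, let u_i be the primitive outer normal of the unique facet of P containing v_i but not v. Then for every i, either u_i = (1,…,1) or u_i = (1,…,1) − e_j for some j ≠ i; moreover u_i = (1,…,1) holds exactly when ℓ_i = n + 1, and u_i = (1,…,1) − e_j for some j ≠ i holds exactly when ℓ_i = n. -/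
open Finset

theorem exists_dotR_eq {n : ℕ} (f : (Fin n → ℝ) →ₗ[ℝ] ℝ) :
    ∃ u : Fin n → ℝ, ∀ x, dotR u x = f x := by
  refine ⟨fun i => f (fun j => if i = j then 1 else 0), fun x => ?_⟩
  rw [LinearMap.pi_apply_eq_sum_univ f x]
  exact Finset.sum_congr rfl fun i _ => mul_comm _ _

theorem isFaceOf_of_linearMap {n : ℕ} {P F : Set (Fin n → ℝ)} (f : (Fin n → ℝ) →ₗ[ℝ] ℝ)
    (hF : F = {x ∈ P | ∀ y ∈ P, f y ≤ f x}) : IsFaceOf P F := by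
  obtain ⟨u, hu⟩ := exists_dotR_eq f
  exact ⟨u, by simp only [hF, hu]⟩

theorem IsVertexOf.exists_linearMap_lt {n : ℕ} {P : Set (Fin n → ℝ)} {w : Fin n → ℝ}
    (hw : IsVertexOf P w) :
    w ∈ P ∧ ∃ c : (Fin n → ℝ) →ₗ[ℝ] ℝ, ∀ x ∈ P, x ≠ w → c x < c w := by
  obtain ⟨u, hu⟩ := hw
  have hmem : w ∈ {x ∈ P | ∀ y ∈ P, dotR u y ≤ dotR u x} := hu ▸ Set.mem_singleton w
  refine ⟨hmem.1, dotProductBilin ℝ ℝ u, fun x hx hne => ?_⟩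
  by_contra! hle
  exact hne (show x ∈ ({w} : Set (Fin n → ℝ)) from
    hu ▸ ⟨hx, fun y hy => (hmem.2 y hy).trans hle⟩)

theorem convex_lt_or_mem {E : Type*} [AddCommGroup E] [Module ℝ E] (f : E →ₗ[ℝ] ℝ) (m : ℝ)
    {C : Set E} (hC : Convex ℝ C) (hf : ∀ x ∈ C, f x = m) :
    Convex ℝ {x | f x < m ∨ x ∈ C} := by
  intro x hx y hy a b ha hb hab
  have hle : ∀ z, (f z < m ∨ z ∈ C) → f z ≤ m := fun z hz => hz.elim le_of_lt fun h => (hf z h).le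
  have hxm := hle x hx
  have hym := hle y hy
  rcases ha.eq_or_lt with rfl | ha
  · obtain rfl : b = 1 := by linarith
    simpa using hy
  rcases hb.eq_or_lt with rfl | hb
  · obtain rfl : a = 1 := by linarith
    simpa using hx
  obtain rfl : b = 1 - a := by linarith
  rcases hx with hx | hx
  · left
    simp only [map_add, map_smul, smul_eq_mul]
    nlinarith
  rcases hy with hy | hy
  · left
    simp only [map_add, map_smul, smul_eq_mul]
    nlinarith
  · exact Or.inr (hC hx hy ha.le hb.le hab)

/-- If a supporting functional at `w` singles out a ray among the generators of a polytope,
then that ray spans an edge. -/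
theorem exists_isEdgeOf_of_ray {n : ℕ} {V : Finset (Fin n → ℝ)} {w s : Fin n → ℝ}
    (hw : w ∈ convexHull ℝ (V : Set (Fin n → ℝ))) (hs : s ≠ 0)
    (f : (Fin n → ℝ) →ₗ[ℝ] ℝ) (hfs : f s = 0)
    (hV : ∀ x ∈ V, f x < f w ∨ ∃ t : ℝ, 0 ≤ t ∧ x = w + t • s)
    (hex : ∃ t : ℝ, 0 < t ∧ w + t • s ∈ V) :
    ∃ t : ℝ, 0 < t ∧ IsEdgeOf (convexHull ℝ (V : Set (Fin n → ℝ))) (segment ℝ w (w + t • s)) := by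
  have hinj : Function.Injective fun t : ℝ => w + t • s := fun a b hab =>
    smul_left_injective ℝ hs (add_left_cancel hab)
  obtain ⟨t₀, ht₀, ht₀V⟩ := hex
  obtain ⟨t, htV, htmax⟩ := Set.exists_max_image {t : ℝ | w + t • s ∈ V} id
    (V.finite_toSet.preimage hinj.injOn) ⟨t₀, ht₀V⟩
  have htpos : 0 < t := ht₀.trans_le (htmax t₀ ht₀V)
  have hseg : ∀ x ∈ segment ℝ w (w + t • s), f x = f w := by
    rintro x ⟨a, b, -, -, hab, rfl⟩
    simp only [map_add, map_smul, smul_eq_mul, hfs, mul_zero, add_zero]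
    rw [← add_mul, hab, one_mul]
  have hsub : convexHull ℝ (V : Set (Fin n → ℝ)) ⊆
      {x | f x < f w ∨ x ∈ segment ℝ w (w + t • s)} := by
    refine convexHull_min (fun x hx => ?_) (convex_lt_or_mem f _ (convex_segment _ _) hseg)
    rcases hV x hx with h | ⟨r, hr, rfl⟩
    · exact Or.inl h
    · right
      have hrt : r ≤ t := htmax r hx
      refine (mem_segment_iff_sameRay (𝕜 := ℝ)).2 ?_
      have h₁ : w + r • s - w = r • s := by abel
      have h₂ : w + t • s - (w + r • s) = (t - r) • s := by rw [sub_smul]; abel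
      rw [h₁, h₂]
      exact ((SameRay.refl s).nonneg_smul_left hr).nonneg_smul_right (sub_nonneg.2 hrt)
  have hle : ∀ y ∈ convexHull ℝ (V : Set (Fin n → ℝ)), f y ≤ f w := fun y hy =>
    (hsub hy).elim le_of_lt fun h => (hseg y h).le
  refine ⟨t, htpos, isFaceOf_of_linearMap f ?_, w, w + t • s, ?_, rfl⟩
  · ext x
    constructor
    · intro hx
      refine ⟨(convex_convexHull ℝ _).segment_subset hw (subset_convexHull ℝ _ htV) hx, ?_⟩
      rw [hseg x hx]
      exact hle
    · rintro ⟨hx, hmax⟩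
      exact (hsub hx).resolve_left (hmax w hw).not_gt
  · simp [htpos.ne', hs]

/-- A finite set lies in the convex hull of its points that are strictly exposed in it. -/
theorem subset_convexHull_strictly_exposed {n : ℕ} {S : Set (Fin n → ℝ)} (hS : S.Finite) :
    S ⊆ convexHull ℝ {s ∈ S | ∃ g : (Fin n → ℝ) →ₗ[ℝ] ℝ, ∀ y ∈ S, y ≠ s → g y < g s} := by
  have hext : (convexHull ℝ S).extremePoints ℝ ⊆
      {s ∈ S | ∃ g : (Fin n → ℝ) →ₗ[ℝ] ℝ, ∀ y ∈ S, y ≠ s → g y < g s} := by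
    intro s hs
    refine ⟨extremePoints_convexHull_subset hs, ?_⟩
    have hnot : s ∉ convexHull ℝ (S \ {s}) := fun hmem =>
      ((convex_convexHull ℝ S).mem_extremePoints_iff_mem_sdiff_convexHull_sdiff.1 hs).2
        (convexHull_mono (Set.sdiff_subset_sdiff_left (subset_convexHull ℝ S)) hmem)
    obtain ⟨g, a, hga, hgs⟩ := geometric_hahn_banach_closed_point (convex_convexHull ℝ _)
      ((hS.subset Set.sdiff_subset).isClosed_convexHull ℝ) hnot
    exact ⟨g.toLinearMap, fun y hy hne =>
      (hga y (subset_convexHull ℝ _ ⟨hy, hne⟩)).trans hgs⟩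
  have hfin : ((convexHull ℝ S).extremePoints ℝ).Finite :=
    hS.subset extremePoints_convexHull_subset
  calc S ⊆ convexHull ℝ S := subset_convexHull ℝ S
    _ = closure (convexHull ℝ ((convexHull ℝ S).extremePoints ℝ)) :=
      (closure_convexHull_extremePoints (hS.isCompact_convexHull ℝ) (convex_convexHull ℝ S)).symm
    _ = convexHull ℝ ((convexHull ℝ S).extremePoints ℝ) := (hfin.isClosed_convexHull ℝ).closure_eq
    _ ⊆ _ := convexHull_mono hext

/-- At a vertex `w`, a polytope lies in any translated convex cone containing its edges at `w`. -/
theorem sub_mem_of_edges_mem {n : ℕ} {P : Set (Fin n → ℝ)} (hP : IsLatticePolytope P)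
    {w : Fin n → ℝ} (hw : IsVertexOf P w) {K : Set (Fin n → ℝ)} (hK : Convex ℝ K) (hK0 : 0 ∈ K)
    (hKs : ∀ t : ℝ, 0 < t → ∀ x ∈ K, t • x ∈ K)
    (hedge : ∀ x, x ≠ w → IsEdgeOf P (segment ℝ w x) → x - w ∈ K) :
    ∀ x ∈ P, x - w ∈ K := by
  obtain ⟨V, -, rfl, -⟩ := hP
  obtain ⟨hwP, c, hc⟩ := hw.exists_linearMap_lt
  have hVP : (V : Set (Fin n → ℝ)) ⊆ convexHull ℝ (V : Set (Fin n → ℝ)) := subset_convexHull ℝ _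
  let φ : (Fin n → ℝ) → (Fin n → ℝ) := fun x => (c w - c x)⁻¹ • (x - w)
  let S : Set (Fin n → ℝ) := φ '' ((V : Set (Fin n → ℝ)) \ {w})
  have hSfin : S.Finite := (V.finite_toSet.subset Set.sdiff_subset).image φ
  have hpos : ∀ x ∈ V, x ≠ w → 0 < c w - c x := fun x hx hne =>
    sub_pos.2 (hc x (hVP hx) hne)
  have hφ : ∀ x ∈ V, x ≠ w → x = w + (c w - c x) • φ x := by
    intro x hx hne
    simp only [φ]
    rw [smul_inv_smul₀ (hpos x hx hne).ne']
    abel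
  have hcφ : ∀ x ∈ V, x ≠ w → c (φ x) = -1 := by
    intro x hx hne
    have := (hpos x hx hne).ne'
    simp only [φ, map_smul, map_sub, smul_eq_mul]
    field_simp
    ring
  have hSK : S ⊆ K := by
    refine (subset_convexHull_strictly_exposed hSfin).trans (convexHull_min ?_ hK)
    rintro _ ⟨⟨x, ⟨hxV, hxw⟩, rfl⟩, g, hg⟩
    have hs0 : φ x ≠ 0 := fun h => by simpa [h] using hcφ x hxV hxw
    have hray : ∀ y ∈ V, (g + g (φ x) • c) y < (g + g (φ x) • c) w ∨
        ∃ t : ℝ, 0 ≤ t ∧ y = w + t • φ x := by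
      intro y hy
      by_cases hyw : y = w
      · exact Or.inr ⟨0, le_rfl, by simp [hyw]⟩
      by_cases hyx : φ y = φ x
      · exact Or.inr ⟨_, (hpos y hy hyw).le, hyx ▸ hφ y hy hyw⟩
      · left
        have hgy := hg (φ y) ⟨y, ⟨hy, hyw⟩, rfl⟩ hyx
        have hr := hpos y hy hyw
        have hcy := hcφ y hy hyw
        have hy_eq := hφ y hy hyw
        generalize φ y = q at hgy hcy hy_eq
        generalize c w - c y = r at hr hy_eq
        subst hy_eq
        simp only [map_add, map_smul, LinearMap.add_apply, LinearMap.smul_apply, smul_eq_mul, hcy]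
        nlinarith
    obtain ⟨t, ht, hE⟩ := exists_isEdgeOf_of_ray hwP hs0 (g + g (φ x) • c)
      (by simp [hcφ x hxV hxw]) hray
      ⟨c w - c x, hpos x hxV hxw, by rw [← hφ x hxV hxw]; exact hxV⟩
    have h := hedge _ (by simp [ht.ne', hs0]) hE
    have h' := hKs t⁻¹ (inv_pos.2 ht) _ h
    rwa [add_sub_cancel_left, inv_smul_smul₀ ht.ne'] at h'
  have hset : Convex ℝ {x | x - w ∈ K} := by
    have h := hK.translate_preimage_left (-w)
    simp only [← sub_eq_add_neg] at h
    exact h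
  refine fun x hx => convexHull_min (fun y hy => ?_) hset hx
  by_cases hyw : y = w
  · simpa [hyw] using hK0
  · have := hKs _ (hpos y hy hyw) _ (hSK ⟨y, ⟨hy, hyw⟩, rfl⟩)
    simp only [φ] at this
    rwa [smul_inv_smul₀ (hpos y hy hyw).ne'] at this

/-- At a vertex of a smooth polytope, a facet normal is a unit on the direction of a coordinate
edge that leaves the facet. -/
theorem IsFacetNormal.isUnit_apply_of_edge {n : ℕ} {P F : Set (Fin n → ℝ)} {u : Fin n → ℤ}
    (hF : IsFacetNormal P F u) (hL : IsLatticePolytope P) (hS : IsSmoothPolytope P)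
    {w : Fin n → ℝ} (hw : IsVertexOf P w) (hwF : w ∈ F) {i : Fin n} {s : ℝ}
    (hE : IsEdgeOf P (segment ℝ w (w + s • Pi.single i 1))) (hui : u i ≠ 0) :
    IsUnit (u i) := by
  obtain ⟨-, E, d, -, hEd, hall, hdet⟩ := hS w hw
  obtain ⟨hprim, ⟨-, -, hdim⟩, hFeq⟩ := hF
  let f : (Fin n → ℝ) →ₗ[ℝ] ℝ := dotProductBilin ℝ ℝ (fun j => (u j : ℝ))
  have hmax : ∀ y ∈ P, f y ≤ f w := (hFeq ▸ hwF : w ∈ {x ∈ P | ∀ y ∈ P, dotZ u y ≤ dotZ u x}).2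
  let D : Fin n → Fin n → ℝ := fun k j => (d k j : ℝ)
  have hfD : ∀ k, f (D k) = ((∑ j, d k j * u j : ℤ) : ℝ) := fun k => by
    push_cast
    change ∑ j, (u j : ℝ) * d k j = _
    exact Finset.sum_congr rfl fun j _ => mul_comm _ _
  have hfD_le : ∀ k, f (D k) ≤ 0 := by
    intro k
    obtain ⟨⟨⟨c, hc⟩, -⟩, -, -, y, hy, t, ht, hyt⟩ := hEd k
    have hyP : y ∈ P := (hc ▸ hy : y ∈ {x ∈ P | _}).1
    have hyw : y - w = t • D k := funext hyt
    have h := hmax y hyP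
    rw [← sub_nonpos, ← map_sub, hyw, map_smul, smul_eq_mul] at h
    exact nonpos_of_mul_nonpos_right h ht
  let W : Submodule ℝ (Fin n → ℝ) := Submodule.span ℝ (Set.range fun k : {k // f (D k) = 0} => D k)
  have hfW : ∀ x ∈ W, f x = 0 := by
    have : W ≤ LinearMap.ker f := Submodule.span_le.2 (by rintro _ ⟨k, rfl⟩; exact k.2)
    exact this
  have hcone : ∀ x ∈ P, f (x - w) < 0 ∨ x - w ∈ W := by
    refine sub_mem_of_edges_mem (K := {x | f x < 0 ∨ x ∈ W}) hL hw
      (convex_lt_or_mem f 0 W.convex hfW) (Or.inr W.zero_mem) ?_ ?_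
    · rintro t ht x (hx | hx)
      · left
        rw [map_smul, smul_eq_mul]
        exact mul_neg_of_pos_of_neg ht hx
      · exact Or.inr (W.smul_mem t hx)
    · intro x hxw hx
      obtain ⟨k, hk⟩ := hall _ hx (left_mem_segment ℝ w x)
      obtain ⟨-, -, -, y, hy, t, ht, hyt⟩ := hEd k
      have hyw : y - w = t • D k := funext hyt
      rw [← hk, segment_eq_image'] at hy
      obtain ⟨θ, ⟨hθ, -⟩, rfl⟩ := hy
      rw [add_sub_cancel_left] at hyw
      rcases hθ.eq_or_lt with rfl | hθ
      · have hD : D k = 0 := by simpa [ht.ne'] using hyw.symm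
        have hz : ∀ j, d k j = 0 := fun j => by
          have h : (d k j : ℝ) = 0 := congrFun hD j
          exact_mod_cast h
        have hp : IsPrimitiveZ (d k) := (hEd k).2.2.1
        rw [IsPrimitiveZ, Finset.gcd_eq_zero_iff.2 fun j _ => hz j] at hp
        exact absurd hp zero_ne_one
      · have hx' : x - w = (θ⁻¹ * t) • D k := by
          rw [mul_smul, ← hyw, inv_smul_smul₀ hθ.ne']
        rcases (hfD_le k).lt_or_eq with h | h
        · left
          rw [hx', map_smul, smul_eq_mul]
          exact mul_neg_of_pos_of_neg (by positivity) h
        · right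
          rw [hx']
          exact W.smul_mem _ (Submodule.subset_span ⟨⟨k, h⟩, rfl⟩)
  have hspan : vectorSpan ℝ F ≤ W := by
    rw [vectorSpan_eq_span_vsub_set_right ℝ hwF, Submodule.span_le]
    rintro _ ⟨x, hx, rfl⟩
    have hx' : x ∈ {x ∈ P | ∀ y ∈ P, dotZ u y ≤ dotZ u x} := hFeq ▸ hx
    refine (hcone x hx'.1).resolve_left ?_
    rw [map_sub, not_lt, sub_nonneg]
    exact hx'.2 w (hFeq ▸ hwF : w ∈ {x ∈ P | _}).1
  have hcard : n ≤ Fintype.card {k // f (D k) = 0} + 1 := by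
    have h : dimSet F ≤ Fintype.card {k // f (D k) = 0} :=
      (Submodule.finrank_mono hspan).trans (finrank_range_le_card _)
    omega
  obtain ⟨k₀, hk₀⟩ := hall _ hE (left_mem_segment ℝ _ _)
  obtain ⟨-, -, hprim₀, y, hy, t, ht, hyt⟩ := hEd k₀
  have hd₀ : ∀ j, j ≠ i → d k₀ j = 0 := by
    intro j hj
    rw [← hk₀, segment_eq_image'] at hy
    obtain ⟨θ, -, rfl⟩ := hy
    have h := hyt j
    simpa [hj, ht.ne'] using h
  have hd₀i : d k₀ i ≠ 0 := by
    intro h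
    have hz : ∀ j, d k₀ j = 0 := fun j => by
      by_cases hj : j = i
      · rw [hj, h]
      · exact hd₀ j hj
    rw [IsPrimitiveZ, Finset.gcd_eq_zero_iff.2 fun j _ => hz j] at hprim₀
    exact zero_ne_one hprim₀
  have hu₀ : ∑ j, d k₀ j * u j = d k₀ i * u i :=
    Finset.sum_eq_single i (fun j _ hj => by rw [hd₀ j hj, zero_mul]) (by simp)
  have hf₀ : f (D k₀) ≠ 0 := by
    rw [hfD, hu₀]
    exact_mod_cast mul_ne_zero hd₀i hui
  have hothers : ∀ k, k ≠ k₀ → f (D k) = 0 := by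
    intro k hk
    by_contra hne
    have hsub : Finset.univ.filter (fun k => f (D k) = 0) ⊆ Finset.univ \ {k, k₀} := by
      intro l hl
      have hl' : f (D l) = 0 := (Finset.mem_filter.1 hl).2
      simp only [Finset.mem_sdiff, Finset.mem_univ, true_and, Finset.mem_insert,
        Finset.mem_singleton, not_or]
      exact ⟨fun h => hne (h ▸ hl'), fun h => hf₀ (h ▸ hl')⟩
    have hle := Finset.card_le_card hsub
    have hpair := Finset.card_sdiff_add_card_eq_card (Finset.subset_univ {k, k₀})
    rw [Finset.card_pair hk, Finset.card_univ, Fintype.card_fin] at hpair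
    rw [Fintype.card_subtype] at hcard
    omega
  have hmul : (Matrix.of d).mulVec u = Pi.single k₀ (d k₀ i * u i) := by
    funext k
    change ∑ j, d k j * u j = _
    by_cases hk : k = k₀
    · subst hk
      rw [hu₀, Pi.single_eq_same]
    · rw [Pi.single_eq_of_ne hk]
      have h := hothers k hk
      rw [hfD] at h
      exact_mod_cast h
  have hdvd : ∀ j, u i ∣ u j := by
    intro j
    have h : u = (Matrix.of d)⁻¹.mulVec (Pi.single k₀ (d k₀ i * u i)) := by
      rw [← hmul, Matrix.mulVec_mulVec, Matrix.nonsing_inv_mul _ hdet, Matrix.one_mulVec]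
    refine (Dvd.intro_left ((Matrix.of d)⁻¹ j k₀ * d k₀ i) ?_)
    conv_rhs => rw [h]
    rw [Matrix.mulVec_single]
    simp [mul_comm, mul_assoc]
  exact isUnit_of_dvd_one (hprim ▸ Finset.dvd_gcd fun j _ => hdvd j)

theorem dotZ_ite {n : ℕ} (u : Fin n → ℤ) (i : Fin n) (l : ℕ) :
    dotZ u (fun j => if j = i then (l : ℝ) - 1 else -1) = ((u i * l - ∑ j, u j : ℤ) : ℝ) := by
  have h : ∀ j, (u j : ℝ) * (if j = i then (l : ℝ) - 1 else -1) =
      (if j = i then (u j : ℝ) * l else 0) - u j := fun j => by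
    split_ifs <;> ring
  simp only [dotZ, h, Finset.sum_sub_distrib, Finset.sum_ite_eq', Finset.mem_univ, if_true]
  push_cast
  rfl

/-- The integer inequalities satisfied by the normals bound all their entries by one. -/
theorem normal_entry_le_one {n : ℕ} {u : Fin n → Fin n → ℤ} {ℓ : Fin n → ℕ}
    (hl : ∀ i, n ≤ ℓ i) (hdiag : ∀ i, u i i = 1) (hsum : ∀ i, ∑ j, u i j = (ℓ i : ℤ) - 1)
    (hle : ∀ i j, u i j * ℓ j ≤ ℓ i) (hsymm : ∀ i j, u i j * ℓ j = ℓ i → u j i * ℓ i = ℓ j)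
    (i j : Fin n) : u i j ≤ 1 := by
  by_contra! hlt
  have hn : 0 < n := i.pos
  have hterm : ∀ k, (n : ℤ) * u i k ≤ ℓ i := by
    intro k
    have hk : (n : ℤ) ≤ ℓ k := by exact_mod_cast hl k
    have := hle i k
    rcases le_or_gt (u i k) 0 with h | h <;> nlinarith
  have hbound : (n : ℤ) * ((ℓ i : ℤ) - 2) ≤ ((n : ℤ) - 1) * ℓ i := by
    have h := Finset.sum_le_card_nsmul (Finset.univ.erase i) (fun k => (n : ℤ) * u i k) (ℓ i)
      fun k _ => hterm k
    have hsplit := Finset.add_sum_erase Finset.univ (u i) (Finset.mem_univ i)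
    rw [hsum, hdiag] at hsplit
    rw [← Finset.mul_sum, Finset.card_erase_of_mem (Finset.mem_univ i), Finset.card_univ,
      Fintype.card_fin, nsmul_eq_mul, Nat.cast_sub hn, Nat.cast_one] at h
    rwa [show (ℓ i : ℤ) - 2 = ∑ k ∈ Finset.univ.erase i, u i k by linarith]
  have hj : (n : ℤ) ≤ ℓ j := by exact_mod_cast hl j
  have hn' : (0 : ℤ) < n := by exact_mod_cast hn
  have hij := hle i j
  have hmul : 2 * (ℓ j : ℤ) ≤ u i j * ℓ j := mul_le_mul_of_nonneg_right hlt (by omega)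
  have hli : (ℓ i : ℤ) = 2 * ℓ j := by linarith
  have h := hsymm i j (by linarith)
  have h2 : (u j i * 2) * (ℓ j : ℤ) = 1 * ℓ j := by rw [hli] at h; linarith
  have h3 := mul_right_cancel₀ (by omega : (ℓ j : ℤ) ≠ 0) h2
  omega

theorem eq_one_or_eq_one_sub_single {n : ℕ} {x : Fin n → ℤ} (hx : ∀ j, x j ≤ 1) {l : ℕ}
    (hl : n ≤ l) (hsum : ∑ j, x j = (l : ℤ) - 1) {i : Fin n} (hi : x i = 1) :
    ((x = fun _ => 1) ∧ l = n + 1) ∨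
      ((∃ j, j ≠ i ∧ x = fun m => if m = j then 0 else 1) ∧ l = n) := by
  have hdef : ∑ j, (1 - x j) = (n : ℤ) + 1 - l := by
    simp [hsum]
    ring
  by_cases hall : ∀ j, x j = 1
  · left
    refine ⟨funext hall, ?_⟩
    simp only [hall, sub_self, Finset.sum_const_zero] at hdef
    omega
  · right
    push Not at hall
    obtain ⟨j, hj⟩ := hall
    have hsplit := Finset.add_sum_erase Finset.univ (fun k => 1 - x k) (Finset.mem_univ j)
    have hnonneg : ∀ k ∈ Finset.univ.erase j, 0 ≤ 1 - x k := fun k _ => sub_nonneg.2 (hx k)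
    have hrest := Finset.sum_nonneg hnonneg
    have hxj := hx j
    beta_reduce at hsplit
    have hzero : ∑ k ∈ Finset.univ.erase j, (1 - x k) = 0 := by omega
    refine ⟨⟨j, fun h => hj (h ▸ hi), funext fun m => ?_⟩, by omega⟩
    split_ifs with hm
    · subst hm
      omega
    · have := (Finset.sum_eq_zero_iff_of_nonneg hnonneg).1 hzero m
        (Finset.mem_erase.2 ⟨hm, Finset.mem_univ m⟩)
      omega

/-- let `P ⊆ ℝ^n` be a monotone polytope with vertex
`v = -(1,…,1)` whose incident facets are supported on `{x : x i = -1}`, with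
neighbors `vᵢ = v + ℓᵢ eᵢ` where `ℓᵢ ≥ n`, and let `uᵢ` be the primitive outer
normal of the unique facet containing `vᵢ` but not `v`. Then either
`uᵢ = (1,…,1)` and `ℓᵢ = n + 1`, or `uᵢ = (1,…,1) - eⱼ` for some `j ≠ i` and
`ℓᵢ = n`. -/
theorem facet_normals_at_long_vertex {n : ℕ} (P : Set (Fin n → ℝ))
    (hP : IsMonotonePolytope P)
    (hv : IsVertexOf P (fun _ => -1))
    (hfac : ∀ i : Fin n, IsFacetNormal P {x ∈ P | x i = -1}
      (fun j => if j = i then -1 else 0))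
    (hfac' : ∀ F, IsFacetOf P F → (fun _ => (-1 : ℝ)) ∈ F →
      ∃ i, F = {x ∈ P | x i = -1})
    (ℓ : Fin n → ℕ) (hl : ∀ i, n ≤ ℓ i)
    (hnb : ∀ i : Fin n,
      IsVertexOf P (fun j => if j = i then (ℓ i : ℝ) - 1 else -1) ∧
      IsEdgeOf P (segment ℝ (fun _ => -1)
        (fun j => if j = i then (ℓ i : ℝ) - 1 else -1)))
    (hnb' : ∀ E, IsEdgeOf P E → (fun _ => (-1 : ℝ)) ∈ E →
      ∃ i, E = segment ℝ (fun _ => -1)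
        (fun j => if j = i then (ℓ i : ℝ) - 1 else -1))
    (u : Fin n → Fin n → ℤ)
    (huniq : ∀ i : Fin n, ∃! F : Set (Fin n → ℝ), IsFacetOf P F ∧
      (fun j => if j = i then (ℓ i : ℝ) - 1 else -1) ∈ F ∧
      (fun _ => (-1 : ℝ)) ∉ F)
    (hu : ∀ (i : Fin n) (F : Set (Fin n → ℝ)), IsFacetOf P F →
      (fun j => if j = i then (ℓ i : ℝ) - 1 else -1) ∈ F →
      (fun _ => (-1 : ℝ)) ∉ F → IsFacetNormal P F (u i)) :
    ∀ i : Fin n,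
      ((u i = fun _ => 1) ∧ ℓ i = n + 1) ∨
      ((∃ j, j ≠ i ∧ u i = fun m => if m = j then 0 else 1) ∧ ℓ i = n) := by
  obtain ⟨hL, hS, -, hR⟩ := hP
  choose F hF _ using huniq
  have hN : ∀ i, IsFacetNormal P (F i) (u i) := fun i =>
    hu i _ (hF i).1 (hF i).2.1 (hF i).2.2
  have hone : ∀ i, ∀ x ∈ F i, dotZ (u i) x = 1 := fun i => hR _ _ (hN i)
  have hmem : ∀ i x, x ∈ F i ↔ x ∈ P ∧ 1 ≤ dotZ (u i) x := by
    intro i x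
    refine ⟨fun hx => ⟨((hN i).2.2 ▸ hx : x ∈ {x ∈ P | _}).1, (hone i x hx).ge⟩, ?_⟩
    rintro ⟨hx, hle⟩
    rw [(hN i).2.2]
    have hvi : _ ∈ {x ∈ P | _} := (hN i).2.2 ▸ (hF i).2.1
    exact ⟨hx, fun y hy => (hvi.2 y hy).trans ((hone i _ (hF i).2.1).le.trans hle)⟩
  have hle : ∀ i, ∀ x ∈ P, dotZ (u i) x ≤ 1 := fun i x hx => by
    by_contra! h
    exact h.ne' (hone i x ((hmem i x).2 ⟨hx, h.le⟩))
  have hvP : (fun _ => (-1 : ℝ)) ∈ P := hv.exists_linearMap_lt.1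
  have hnP := fun i => (hnb i).1.exists_linearMap_lt.1
  have hself : ∀ i, u i i * ℓ i - ∑ j, u i j = 1 := fun i => by
    have h := hone i _ (hF i).2.1
    rw [dotZ_ite] at h
    exact_mod_cast h
  have hsum_nonneg : ∀ i, 0 ≤ ∑ j, u i j := fun i => by
    have h : dotZ (u i) (fun _ => -1) < 1 := by
      by_contra! h
      exact (hF i).2.2 ((hmem i _).2 ⟨hvP, h⟩)
    have hval : dotZ (u i) (fun _ => -1) = ((-∑ j, u i j : ℤ) : ℝ) := by
      simp [dotZ]
    rw [hval] at h
    have : -∑ j, u i j < 1 := by exact_mod_cast h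
    omega
  have hpos : ∀ i, 0 < u i i := fun i => by
    have h₁ := hself i
    have h₂ := hsum_nonneg i
    exact pos_of_mul_pos_left (by omega : 0 < u i i * (ℓ i : ℤ)) (by positivity)
  have hdiag : ∀ i, u i i = 1 := fun i => by
    have hedge := (hnb i).2
    rw [segment_symm] at hedge
    have hv_eq : (fun _ => (-1 : ℝ)) = (fun j => if j = i then (ℓ i : ℝ) - 1 else -1) +
        (-(ℓ i : ℝ)) • Pi.single i 1 := by
      funext j
      by_cases hj : j = i
      · subst hj
        simp only [if_true, Pi.add_apply, Pi.smul_apply, Pi.single_eq_same, smul_eq_mul]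
        ring
      · simp [hj]
    rw [hv_eq] at hedge
    have h := (hN i).isUnit_apply_of_edge hL hS (hnb i).1 (hF i).2.1 hedge (hpos i).ne'
    have := hpos i
    rcases Int.isUnit_iff.1 h with h | h <;> omega
  have hsum : ∀ i, ∑ j, u i j = (ℓ i : ℤ) - 1 := fun i => by
    have h := hself i
    rw [hdiag] at h
    omega
  have hentry : ∀ i j, u i j * ℓ j ≤ ℓ i := fun i j => by
    have h := hle i _ (hnP j)
    rw [dotZ_ite, hsum] at h
    have : u i j * ℓ j - (ℓ i - 1 : ℤ) ≤ 1 := by exact_mod_cast h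
    omega
  have hsymm : ∀ i j, u i j * ℓ j = ℓ i → u j i * ℓ i = ℓ j := fun i j hij => by
    have hmj : (fun k => if k = j then (ℓ j : ℝ) - 1 else -1) ∈ F i := by
      refine (hmem i _).2 ⟨hnP j, ?_⟩
      rw [dotZ_ite, hsum, hij]
      simp
    have h := hR _ _ (hu j _ (hF i).1 hmj (hF i).2.2) _ (hF i).2.1
    rw [dotZ_ite, hsum] at h
    have : u j i * ℓ i - (ℓ j - 1 : ℤ) = 1 := by exact_mod_cast h
    omega
  exact fun i => eq_one_or_eq_one_sub_single (normal_entry_le_one hl hdiag hsum hentry hsymm i)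
    (hl i) (hsum i) (hdiag i)
end
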